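/- arXiv:1507.01426 — 5 statements merged into one kernel-verified Lean document; each statement's English description precedes it below -/
import Mathlib

section
/- Let n ≥ 4 and let G be the graph obtained from the cycle C_n = v_1 v_2 … v_n v_1 by adding the chord v_{n-1} v_1. Then the 2-proper connection number of G equals 2, i.e., pc_2(G) = 2. -/
/-- A walk in an edge-colored graph is *proper* if no two consecutive edges share a color. -/
def ProperWalk {V : Type*} {G : SimpleGraph V} (c : Sym2 V → ℕ) {u v : V}
    (p : G.Walk u v) : Prop :=
  p.edges.Chain' fun e f => c e ≠ c f

/-- `c` is a proper-path coloring of `G`: every pair of distinct vertices is joined by a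
proper path. -/
def IsProperPathColoring {V : Type*} (G : SimpleGraph V) (c : Sym2 V → ℕ) : Prop :=
  ∀ u v : V, u ≠ v → ∃ p : G.Walk u v, p.IsPath ∧ ProperWalk c p

/-- The proper connection number: the least `k` such that some coloring of the edges with
colors `0, …, k-1` is a proper-path coloring. -/
noncomputable def pc {V : Type*} (G : SimpleGraph V) : ℕ :=
  sInf {k | ∃ c : Sym2 V → ℕ, (∀ e ∈ G.edgeSet, c e < k) ∧ IsProperPathColoring G c}

/-- `G` has the strong property under `c`: any two distinct vertices are joined by two proper
paths whose first-edge colors differ and whose last-edge colors differ. -/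
def HasStrongProperty {V : Type*} (G : SimpleGraph V) (c : Sym2 V → ℕ) : Prop :=
  ∀ u v : V, u ≠ v → ∃ p q : G.Walk u v, p.IsPath ∧ q.IsPath ∧
    ProperWalk c p ∧ ProperWalk c q ∧
    p.edges.head?.map c ≠ q.edges.head?.map c ∧
    p.edges.getLast?.map c ≠ q.edges.getLast?.map c

/-- `c` makes `G` 2-proper connected: any two distinct vertices are joined by two
internally vertex-disjoint proper paths. -/
def Is2ProperConnected {V : Type*} (G : SimpleGraph V) (c : Sym2 V → ℕ) : Prop :=
  ∀ u v : V, u ≠ v → ∃ p q : G.Walk u v, p.IsPath ∧ q.IsPath ∧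
    ProperWalk c p ∧ ProperWalk c q ∧ p ≠ q ∧
    ∀ x, x ∈ p.support → x ∈ q.support → x = u ∨ x = v

/-- The 2-proper connection number. -/
noncomputable def pc2 {V : Type*} (G : SimpleGraph V) : ℕ :=
  sInf {k | ∃ c : Sym2 V → ℕ, (∀ e ∈ G.edgeSet, c e < k) ∧ Is2ProperConnected G c}

/-- The cycle `v₁v₂…vₙv₁` (on vertices `0,…,n-1`) together with the chord `v_{n-1}v₁`
(i.e. between the vertices of index `n-2` and `0`). -/
def chordedCycle (n : ℕ) : SimpleGraph (Fin n) :=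
  SimpleGraph.fromRel fun i j =>
    ((j : ℕ) = ((i : ℕ) + 1) % n) ∨ ((i : ℕ) = 0 ∧ (j : ℕ) = n - 2)

theorem exists_walk_of_fun {V : Type*} {G : SimpleGraph V} (f : ℕ → V) (k : ℕ)
    (h : ∀ i < k, G.Adj (f i) (f (i+1))) :
    ∃ p : G.Walk (f 0) (f k), p.support = (List.range (k+1)).map f ∧
      p.edges = (List.range k).map (fun i => s(f i, f (i+1))) := by
  induction k with
  | zero => exact ⟨SimpleGraph.Walk.nil, by simp, by simp⟩
  | succ k ih =>
    obtain ⟨p, hp, hq⟩ := ih (fun i hi => h i (by omega))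
    refine ⟨p.concat (h k (by omega)), ?_, ?_⟩
    · rw [SimpleGraph.Walk.support_concat, hp, List.range_succ (n := k+1)]
      simp
    · rw [SimpleGraph.Walk.edges_concat, hq, List.range_succ (n := k)]
      simp

theorem exists_path_of_fun {V : Type*} {G : SimpleGraph V} (c : Sym2 V → ℕ) (f : ℕ → V) (k : ℕ)
    (u v : V) (hu : f 0 = u) (hv : f k = v)
    (h : ∀ i < k, G.Adj (f i) (f (i+1)))
    (hinj : ∀ i ≤ k, ∀ j ≤ k, f i = f j → i = j)
    (hc : ∀ i, i + 1 < k → c s(f i, f (i+1)) ≠ c s(f (i+1), f (i+2))) :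
    ∃ p : G.Walk u v, p.IsPath ∧ ProperWalk c p ∧ p.length = k ∧
      ∀ x, x ∈ p.support ↔ ∃ i ≤ k, f i = x := by
  subst hu hv
  obtain ⟨p, hp, hq⟩ := exists_walk_of_fun f k h
  refine ⟨p, ?_, ?_, ?_, ?_⟩
  · rw [SimpleGraph.Walk.isPath_def, hp]
    refine List.Nodup.map_on ?_ List.nodup_range
    intro x hx y hy hxy
    rw [List.mem_range] at hx hy
    exact hinj x (by omega) y (by omega) hxy
  · unfold ProperWalk
    rw [hq]
    refine List.isChain_iff_getElem.2 ?_
    intro i hi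
    simp only [List.length_map, List.length_range] at hi
    simpa using hc i hi
  · rw [← SimpleGraph.Walk.length_edges, hq]; simp
  · intro x
    rw [hp]
    simp

/-- Color on pairs of numbers. -/
def colN (a b : ℕ) : ℕ := if a + 1 = b then a % 2 else if b + 1 = a then b % 2 else 1

theorem colN_comm (a b : ℕ) : colN a b = colN b a := by
  unfold colN; split_ifs <;> omega

/-- The coloring. -/
def colE (n : ℕ) : Sym2 (Fin n) → ℕ :=
  Sym2.lift ⟨fun a b => colN a b, fun a b => colN_comm a b⟩

theorem colE_mk {n : ℕ} (a b : Fin n) : colE n s(a, b) = colN a b := rfl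

theorem adj_succ {n : ℕ} (a b : Fin n) (h : (a : ℕ) + 1 = b) : (chordedCycle n).Adj a b := by
  rw [chordedCycle, SimpleGraph.fromRel_adj]
  refine ⟨fun e => by subst e; omega, Or.inl (Or.inl ?_)⟩
  rw [Nat.mod_eq_of_lt (by omega)]; omega

theorem adj_zero {n : ℕ} (hn : 4 ≤ n) (a b : Fin n) (h : (a : ℕ) = 0)
    (hb : (b : ℕ) = n - 1 ∨ (b : ℕ) = n - 2) : (chordedCycle n).Adj a b := by
  rw [chordedCycle, SimpleGraph.fromRel_adj]
  refine ⟨fun e => by subst e; omega, ?_⟩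
  rcases hb with hb | hb
  · refine Or.inr (Or.inl ?_)
    rw [hb, h, show n - 1 + 1 = n by omega, Nat.mod_self]
  · exact Or.inl (Or.inr ⟨h, hb⟩)

theorem two_paths (n : ℕ) (hn : 4 ≤ n) (u v : Fin n) (huv : (u : ℕ) < v) :
    ∃ p q : (chordedCycle n).Walk u v, p.IsPath ∧ q.IsPath ∧
    ProperWalk (colE n) p ∧ ProperWalk (colE n) q ∧ p ≠ q ∧
    ∀ x, x ∈ p.support → x ∈ q.support → x = u ∨ x = v := by
  have hv := v.2
  obtain ⟨m, hm1, hm2, hm3⟩ : ∃ m : ℕ, (m = n - 1 ∨ m = n - 2) ∧ (v : ℕ) ≤ m ∧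
      ((v : ℕ) < m → (m - 1) % 2 = 0) := by
    by_cases h : n % 2 = 0 ∨ (v : ℕ) = n - 1
    · exact ⟨n - 1, by omega, by omega, by omega⟩
    · exact ⟨n - 2, by omega, by omega, by omega⟩
  let g : ℕ → ℕ := fun i => if i ≤ u then u - i else m - (i - u - 1)
  have hg : ∀ i, g i = if i ≤ u then u - i else m - (i - u - 1) := fun _ => rfl
  have hgn : ∀ i, g i < n := by intro i; rw [hg]; split_ifs <;> omega
  let f : ℕ → Fin n := fun i => ⟨g i, hgn i⟩
  let e : ℕ → Fin n := fun i => if h : (u : ℕ) + i < n then ⟨u + i, h⟩ else u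
  have he : ∀ i, (u : ℕ) + i < n → (e i : ℕ) = u + i := by
    intro i hi; simp [e, hi]
  have hf : ∀ i, (f i : ℕ) = g i := fun _ => rfl
  obtain ⟨p, hp1, hp2, hp3, hp4⟩ := exists_path_of_fun (G := chordedCycle n) (colE n) e (v - u) u v
    (Fin.ext (by rw [he _ (by omega)]; omega)) (Fin.ext (by rw [he _ (by omega)]; omega))
    (by
      intro i hi
      apply adj_succ
      rw [he _ (by omega), he _ (by omega)]; omega)
    (by
      intro i hi j hj hij
      have := congrArg Fin.val hij
      rw [he _ (by omega), he _ (by omega)] at this; omega)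
    (by
      intro i hi
      rw [colE_mk, colE_mk, he _ (by omega), he _ (by omega), he _ (by omega)]
      unfold colN
      split_ifs <;> omega)
  obtain ⟨q, hq1, hq2, hq3, hq4⟩ := exists_path_of_fun (G := chordedCycle n) (colE n) f
    (u + 1 + (m - v)) u v
    (Fin.ext (by rw [hf, hg]; split_ifs <;> omega))
    (Fin.ext (by rw [hf, hg]; split_ifs <;> omega))
    (by
      intro i hi
      by_cases h : i = u
      · apply adj_zero hn
        · rw [hf, hg]; split_ifs <;> omega
        · rw [hf, hg]; split_ifs <;> omega
      · apply SimpleGraph.Adj.symm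
        apply adj_succ
        rw [hf, hf, hg, hg]; split_ifs <;> omega)
    (by
      intro i hi j hj hij
      have := congrArg Fin.val hij
      rw [hf, hf, hg, hg] at this; split_ifs at this <;> omega)
    (by
      intro i hi
      rw [colE_mk, colE_mk, hf, hf, hf]
      have h0 := hg i
      have h1 := hg (i+1)
      have h2 := hg (i+2)
      unfold colN
      split_ifs at h0 h1 h2 <;> split_ifs <;> omega)
  refine ⟨p, q, hp1, hq1, hp2, hq2, ?_, ?_⟩
  · intro hpq
    subst hpq
    have h1 : e 1 ∈ p.support := (hp4 _).2 ⟨1, by omega, rfl⟩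
    obtain ⟨i, hi, hi2⟩ := (hq4 _).1 h1
    have := congrArg Fin.val hi2
    rw [he _ (by omega), hf, hg] at this
    split_ifs at this <;> omega
  · intro x hx hy
    obtain ⟨i, hi, hi2⟩ := (hp4 _).1 hx
    obtain ⟨j, hj, hj2⟩ := (hq4 _).1 hy
    have h1 := congrArg Fin.val hi2
    have h2 := congrArg Fin.val hj2
    rw [he _ (by omega)] at h1
    rw [hf, hg] at h2
    have : (x : ℕ) = u ∨ (x : ℕ) = v := by
      split_ifs at h2 <;> omega
    exact this.imp Fin.ext Fin.ext

theorem properWalk_reverse {V : Type*} {G : SimpleGraph V} (c : Sym2 V → ℕ) {u v : V}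
    (p : G.Walk u v) (h : ProperWalk c p) : ProperWalk c p.reverse := by
  unfold ProperWalk at *
  rw [SimpleGraph.Walk.edges_reverse]
  refine List.isChain_reverse.2 ?_
  exact List.IsChain.imp (fun _ _ h => Ne.symm h) h

theorem length_one_of_mono {V : Type*} {G : SimpleGraph V} (c : Sym2 V → ℕ) {u v : V} (huv : u ≠ v)
    (hc : ∀ e ∈ G.edgeSet, c e < 1) (p : G.Walk u v) (h : ProperWalk c p) :
    ∃ h : G.Adj u v, p = SimpleGraph.Walk.cons h SimpleGraph.Walk.nil := by
  cases p with
  | nil => exact absurd rfl huv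
  | cons a p =>
    cases p with
    | nil => exact ⟨a, rfl⟩
    | cons b p =>
      exfalso
      unfold ProperWalk at h
      have h1 := (List.isChain_cons_cons.1 h).1
      have h2 := hc _ ((SimpleGraph.mem_edgeSet G).2 a)
      have h3 := hc _ ((SimpleGraph.mem_edgeSet G).2 b)
      exact h1 ((Nat.lt_one_iff.1 h2).trans (Nat.lt_one_iff.1 h3).symm)

theorem stmt0 (n : ℕ) (hn : 4 ≤ n) : pc2 (chordedCycle n) = 2 := by
  unfold pc2
  apply IsLeast.csInf_eq
  constructor
  · refine ⟨colE n, ?_, ?_⟩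
    · intro e _
      induction e using Sym2.ind with
      | _ a b =>
        rw [colE_mk]; unfold colN; split_ifs <;> omega
    · intro u v huv
      rcases lt_or_gt_of_ne (fun h => huv (Fin.ext h) : (u : ℕ) ≠ v) with h | h
      · exact two_paths n hn u v h
      · obtain ⟨p, q, h1, h2, h3, h4, h5, h6⟩ := two_paths n hn v u h
        refine ⟨p.reverse, q.reverse, h1.reverse, h2.reverse, properWalk_reverse _ _ h3,
          properWalk_reverse _ _ h4, fun h => h5 ?_, ?_⟩
        · rw [← p.reverse_reverse, h, q.reverse_reverse]
        · intro x hx hy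
          rw [SimpleGraph.Walk.support_reverse, List.mem_reverse] at hx hy
          exact (h6 x hx hy).symm
  · rintro k ⟨c, hc, h⟩
    by_contra hk
    have hc' : ∀ e ∈ (chordedCycle n).edgeSet, c e < 1 := fun e he => by
      have := hc e he
      omega
    have hne : (⟨0, by omega⟩ : Fin n) ≠ ⟨1, by omega⟩ := by
      intro h; simp at h
    obtain ⟨p, q, -, -, h3, h4, h5, -⟩ := h _ _ hne
    obtain ⟨_, hp⟩ := length_one_of_mono c hne hc' p h3
    obtain ⟨_, hq⟩ := length_one_of_mono c hne hc' q h4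
    exact h5 (hp.trans hq.symm)
end

section
/- If G is a connected bridgeless graph (a connected graph with no cut-edges) on at least 2 vertices, then pc(G) ≤ 3; moreover there exists a proper-path coloring c of G using at most 3 colors such that G has the strong property under c. -/
namespace PCAux

/-- A proper path from `u` to `v` inside `S` with first color `i` and last color `j`. -/
def PP {V : Type*} (G : SimpleGraph V) (c : Sym2 V → ℕ) (S : Set V) (u v : V) (i j : ℕ) : Prop :=
  ∃ p : G.Walk u v, p.IsPath ∧ (∀ x ∈ p.support, x ∈ S) ∧
    (p.edges.map c).IsChain (· ≠ ·) ∧ (p.edges.map c).head? = some i ∧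
    (p.edges.map c).getLast? = some j

/-- Two proper paths differing in first and last color. -/
def SP {V : Type*} (G : SimpleGraph V) (c : Sym2 V → ℕ) (S : Set V) (u v : V) : Prop :=
  ∃ i j i' j', i ≠ i' ∧ j ≠ j' ∧ PP G c S u v i j ∧ PP G c S u v i' j'

/-- Strong inside a set. -/
def Strong {V : Type*} (G : SimpleGraph V) (c : Sym2 V → ℕ) (S : Set V) : Prop :=
  ∀ u ∈ S, ∀ v ∈ S, u ≠ v → SP G c S u v

variable {V : Type*} {G : SimpleGraph V} {c : Sym2 V → ℕ} {S T : Set V}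

theorem PP.mono {u v : V} {i j : ℕ} (h : PP G c S u v i j) (hST : S ⊆ T) : PP G c T u v i j := by
  obtain ⟨p, h1, h2, h3⟩ := h
  exact ⟨p, h1, fun x hx => hST (h2 x hx), h3⟩

theorem PP.symm {u v : V} {i j : ℕ} (h : PP G c S u v i j) : PP G c S v u j i := by
  obtain ⟨p, h1, h2, h3, h4, h5⟩ := h
  refine ⟨p.reverse, h1.reverse, by simpa using h2, ?_, ?_, ?_⟩
  · rw [SimpleGraph.Walk.edges_reverse, List.map_reverse, List.isChain_reverse]
    exact h3.imp fun a b hab => hab.symm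
  · rw [SimpleGraph.Walk.edges_reverse, List.map_reverse, List.head?_reverse, h5]
  · rw [SimpleGraph.Walk.edges_reverse, List.map_reverse, List.getLast?_reverse, h4]

theorem SP.symm {u v : V} (h : SP G c S u v) : SP G c S v u := by
  obtain ⟨i, j, i', j', h1, h2, h3, h4⟩ := h
  exact ⟨j, i, j', i', h2, h1, h3.symm, h4.symm⟩

theorem SP.mono {u v : V} (h : SP G c S u v) (hST : S ⊆ T) : SP G c T u v := by
  obtain ⟨i, j, i', j', h1, h2, h3, h4⟩ := h
  exact ⟨i, j, i', j', h1, h2, h3.mono hST, h4.mono hST⟩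

theorem isPath_append {u v w : V} {p : G.Walk u v} {q : G.Walk v w} (hp : p.IsPath)
    (hq : q.IsPath) (h : ∀ x ∈ p.support, x ∈ q.support → x = v) : (p.append q).IsPath := by
  rw [SimpleGraph.Walk.isPath_def, SimpleGraph.Walk.support_append]
  have hq' := hq.support_nodup
  rw [← SimpleGraph.Walk.cons_tail_support, List.nodup_cons] at hq'
  rw [List.nodup_append']
  refine ⟨hp.support_nodup, hq'.2, ?_⟩
  intro x hx hx'
  have := h x hx (List.mem_of_mem_tail hx')
  subst this
  exact hq'.1 hx'

theorem PP.comp {u v w : V} {i j k l : ℕ} (h : PP G c S u v i j) (h' : PP G c T v w k l)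
    (hST : ∀ x ∈ S, x ∈ T → x = v) (hjk : j ≠ k) : PP G c (S ∪ T) u w i l := by
  obtain ⟨p, h1, h2, h3, h4, h5⟩ := h
  obtain ⟨q, g1, g2, g3, g4, g5⟩ := h'
  refine ⟨p.append q, isPath_append h1 g1 fun x hx hx' => hST x (h2 x hx) (g2 x hx'), ?_, ?_, ?_, ?_⟩
  · intro x hx
    rw [SimpleGraph.Walk.mem_support_append_iff] at hx
    exact hx.imp (h2 x) (g2 x)
  · rw [SimpleGraph.Walk.edges_append, List.map_append, List.isChain_append]
    refine ⟨h3, g3, ?_⟩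
    rw [h5, g4]
    simpa using hjk
  · rw [SimpleGraph.Walk.edges_append, List.map_append, List.head?_append, h4]; rfl
  · rw [SimpleGraph.Walk.edges_append, List.map_append, List.getLast?_append, g5]; rfl

theorem walk_hit (K : Set V) {u v : V} (p : G.Walk u v) (hv : v ∈ K) :
    ∃ z ∈ K, ∃ (p1 : G.Walk u z) (p2 : G.Walk z v), p = p1.append p2 ∧
      ∀ x ∈ p1.support, x ∈ K → x = z := by
  induction p with
  | nil => exact ⟨_, hv, .nil, .nil, rfl, by simp⟩
  | @cons a b d h p ih =>
    by_cases ha : a ∈ K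
    · exact ⟨a, ha, .nil, .cons h p, rfl, by simp⟩
    · obtain ⟨z, hz, p1, p2, rfl, h3⟩ := ih hv
      refine ⟨z, hz, .cons h p1, p2, rfl, ?_⟩
      intro x hx hxK
      rw [SimpleGraph.Walk.support_cons, List.mem_cons] at hx
      rcases hx with rfl | hx
      · exact absurd hxK ha
      · exact h3 x hx hxK

theorem PP.hit (K : Set V) {u v : V} {i j : ℕ} (h : PP G c S u v i j) (hu : u ∉ K) (hv : v ∈ K) :
    ∃ z ∈ K, z ∈ S ∧ ∃ j', PP G c {x | x ∈ S ∧ (x ∈ K → x = z)} u z i j' := by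
  obtain ⟨p, h1, h2, h3, h4, h5⟩ := h
  obtain ⟨z, hz, p1, p2, rfl, h6⟩ := walk_hit K p hv
  refine ⟨z, hz, h2 z (by simp), ?_⟩
  rw [SimpleGraph.Walk.edges_append, List.map_append] at h3 h4
  cases p1 with
  | nil => exact absurd hz hu
  | cons hadj p1 =>
    have hne : (List.map c (SimpleGraph.Walk.cons hadj p1).edges) ≠ [] := by simp
    refine ⟨_, .cons hadj p1, h1.of_append_left, ?_, h3.left_of_append, ?_,
      List.getLast?_eq_some_getLast hne⟩
    · intro x hx
      exact ⟨h2 x (by rw [SimpleGraph.Walk.mem_support_append_iff]; exact Or.inl hx), h6 x hx⟩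
    · simpa using h4

theorem combine {u v : V} {i j i' j' k l k' l' : ℕ} (h1 : PP G c S u v i j)
    (h2 : PP G c S u v i' j') (hi : i ≠ i') (h3 : PP G c S u v k l) (h4 : PP G c S u v k' l')
    (hl : l ≠ l') : SP G c S u v := by
  by_cases hj : j = j'
  · subst hj
    by_cases hlj : l = j
    · have hlj' : l' ≠ j := fun h => hl (hlj.trans h.symm)
      by_cases hk : k' = i
      · exact ⟨k', l', i', j, by rwa [hk], hlj', h4, h2⟩
      · exact ⟨k', l', i, j, hk, hlj', h4, h1⟩
    · by_cases hk : k = i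
      · exact ⟨k, l, i', j, by rwa [hk], hlj, h3, h2⟩
      · exact ⟨k, l, i, j, hk, hlj, h3, h1⟩
  · exact ⟨i, j, i', j', hi, hj, h1, h2⟩

theorem half (hT : Strong G c T) {x p o : V} (hpT : p ∈ T) (hpS : p ∉ S)
    (hxT : x ∉ T) (hoT : o ∈ T) {i j : ℕ} (h : PP G c S x o i j) :
    ∃ j', PP G c (S ∪ T) x p i j' := by
  obtain ⟨z, hz, hzS, j', hp⟩ := h.hit T hxT hoT
  have hzp : z ≠ p := fun e => hpS (e ▸ hzS)
  obtain ⟨a, b, a', b', ha, hb, q1, q2⟩ := hT z hz p hpT hzp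
  have key : ∀ {k l}, j' ≠ k → PP G c T z p k l → PP G c (S ∪ T) x p i l := fun hk q =>
    (hp.comp q (fun y hy hy' => hy.2 hy') hk).mono
      (Set.union_subset_union_left _ fun y hy => hy.1)
  by_cases hja : j' = a
  · exact ⟨_, key (by rwa [hja]) q2⟩
  · exact ⟨_, key hja q1⟩

theorem cross (hS : Strong G c S) (hT : Strong G c T) {o x p : V} (hoS : o ∈ S) (hoT : o ∈ T)
    (hx : x ∈ S) (hxT : x ∉ T) (hp : p ∈ T) (hpS : p ∉ S) : SP G c (S ∪ T) x p := by
  obtain ⟨i, j, i', j', hi, -, r1, r2⟩ := hS x hx o hoS (fun e => hxT (e ▸ hoT))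
  obtain ⟨k, l, k', l', hk, -, t1, t2⟩ := hT p hp o hoT (fun e => hpS (e ▸ hoS))
  obtain ⟨_, w1⟩ := half hT hp hpS hxT hoT r1
  obtain ⟨_, w2⟩ := half hT hp hpS hxT hoT r2
  obtain ⟨_, s1⟩ := half hS hx hxT hpS hoS t1
  obtain ⟨_, s2⟩ := half hS hx hxT hpS hoS t2
  rw [Set.union_comm] at s1 s2
  exact combine w1 w2 hi s1.symm s2.symm hk

theorem Strong.union (hS : Strong G c S) (hT : Strong G c T) {o : V} (hoS : o ∈ S) (hoT : o ∈ T) :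
    Strong G c (S ∪ T) := by
  intro u hu v hv huv
  by_cases h1 : u ∈ S ∧ v ∈ S
  · exact (hS u h1.1 v h1.2 huv).mono Set.subset_union_left
  by_cases h2 : u ∈ T ∧ v ∈ T
  · exact (hT u h2.1 v h2.2 huv).mono Set.subset_union_right
  rcases hu with hu | hu <;> rcases hv with hv | hv
  · exact absurd ⟨hu, hv⟩ h1
  · exact cross hS hT hoS hoT hu (fun h => h2 ⟨h, hv⟩) hv (fun h => h1 ⟨hu, h⟩)
  · exact (cross hS hT hoS hoT hv (fun h => h2 ⟨hu, h⟩) hu (fun h => h1 ⟨h, hv⟩)).symm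
  · exact absurd ⟨hu, hv⟩ h2

theorem strong_cycle {o : V} (C : G.Walk o o) (hC : C.IsCycle)
    (hch : Cycle.Chain (· ≠ ·) ((C.edges.map c : List ℕ) : Cycle ℕ)) :
    Strong G c {x | x ∈ C.support} := by
  classical
  intro u hu v hv huv
  have hC' := hC.rotate hu
  have hv' : v ∈ (C.rotate u hu).support := by
    rw [SimpleGraph.Walk.mem_support_rotate_iff]; exact hv
  have hch' : Cycle.Chain (· ≠ ·) (((C.rotate u hu).edges.map c : List ℕ) : Cycle ℕ) := by
    have : (((C.rotate u hu).edges.map c : List ℕ) : Cycle ℕ) = (C.edges.map c : List ℕ) :=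
      Cycle.coe_eq_coe.2 ((SimpleGraph.Walk.rotate_edges C u hu).map c)
    rwa [this]
  have hsup : ∀ x, x ∈ (C.rotate u hu).support → x ∈ C.support := fun x hx => by
    rwa [SimpleGraph.Walk.mem_support_rotate_iff] at hx
  generalize C.rotate u hu = D at hC' hv' hch' hsup
  obtain ⟨A, B, rfl⟩ := SimpleGraph.Walk.mem_support_iff_exists_append.1 hv'
  have hA : ¬ A.Nil := fun h => huv h.eq
  have hB : ¬ B.Nil := fun h => huv h.eq.symm
  have pA := hC'.isPath_of_append_left hB
  have pB := hC'.isPath_of_append_right hA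
  have hsA : ∀ x ∈ A.support, x ∈ C.support := fun x hx =>
    hsup x (by rw [SimpleGraph.Walk.mem_support_append_iff]; exact Or.inl hx)
  have hsB : ∀ x ∈ B.support, x ∈ C.support := fun x hx =>
    hsup x (by rw [SimpleGraph.Walk.mem_support_append_iff]; exact Or.inr hx)
  rw [SimpleGraph.Walk.edges_append, List.map_append] at hch'
  have hA' : A.edges.map c ≠ [] := by
    simpa [SimpleGraph.Walk.edges_eq_nil] using hA
  have hB' : B.edges.map c ≠ [] := by
    simpa [SimpleGraph.Walk.edges_eq_nil] using hB
  have gA := List.getLast?_eq_some_getLast hA'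
  have gB := List.getLast?_eq_some_getLast hB'
  have fA := List.head?_eq_some_head hA'
  have fB := List.head?_eq_some_head hB'
  have hchain : (A.edges.map c).IsChain (· ≠ ·) ∧ (B.edges.map c).IsChain (· ≠ ·) ∧
      (A.edges.map c).head hA' ≠ (B.edges.map c).getLast hB' ∧
      (A.edges.map c).getLast hA' ≠ (B.edges.map c).head hB' := by
    rw [Cycle.chain_ne_nil _ (by simp [hA'] : A.edges.map c ++ B.edges.map c ≠ []),
      List.isChain_cons, List.isChain_append] at hch'
    obtain ⟨h1, h2, h3, h4⟩ := hch'
    refine ⟨h2, h3, ?_, ?_⟩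
    · have := h1 ((A.edges.map c).head hA') (by simp [List.head?_append, fA])
      rw [List.getLast_append_of_ne_nil _ hB'] at this
      exact this.symm
    · exact h4 _ gA _ fB
  obtain ⟨h1, h2, h3, h4⟩ := hchain
  exact ⟨_, _, _, _, h3, h4, ⟨A, pA, hsA, h1, fA, gA⟩, PP.symm ⟨B, pB, hsB, h2, fB, gB⟩⟩

theorem color_list : ∀ (l : List (Sym2 V)) (c : Sym2 V → ℕ) (α β : ℕ), l.Nodup → 2 ≤ l.length →
    (∀ e, c e < 3) → α < 3 → β < 3 → α ≠ β →
    ∃ c' : Sym2 V → ℕ, (∀ e, c' e < 3) ∧ (∀ e, e ∉ l → c' e = c e) ∧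
      (l.map c').IsChain (· ≠ ·) ∧ (l.map c').head? = some α ∧ (l.map c').getLast? = some β := by
  classical
  intro l
  induction l with
  | nil => intro c α β _ h; simp at h
  | cons e l ih =>
    intro c α β hnd hlen hc hα hβ hαβ
    rw [List.nodup_cons] at hnd
    have hmap : ∀ (f : Sym2 V → ℕ), l.map (Function.update f e α) = l.map f := fun f =>
      List.map_congr_left fun x hx => Function.update_of_ne (ne_of_mem_of_not_mem hx hnd.1) _ _
    obtain ⟨d, hd1, hd2, hd3, hd4, hd5⟩ : ∃ d : Sym2 V → ℕ, (∀ e, d e < 3) ∧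
        (∀ e, e ∉ l → d e = c e) ∧ (l.map d).IsChain (· ≠ ·) ∧
        (∀ y ∈ (l.map d).head?, α ≠ y) ∧ (l.map d).getLast? = some β := by
      match l, ih, hnd, hlen with
      | [f], _, _, _ =>
        refine ⟨Function.update c f β, ?_, ?_, ?_⟩
        · intro e; by_cases h : e = f
          · subst h; simpa using hβ
          · rw [Function.update_of_ne h]; exact hc e
        · intro e h; exact Function.update_of_ne (by simpa using h) _ _
        · simpa using hαβ
      | f :: g :: l, ih, hnd, _ =>
        obtain ⟨γ, h1, h2, h3⟩ : ∃ γ, γ < 3 ∧ γ ≠ α ∧ γ ≠ β :=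
          ⟨3 - α - β, by omega, by omega, by omega⟩
        obtain ⟨d, k1, k2, k3, k4, k5⟩ := ih c γ β hnd.2 (by simp) hc h1 hβ h3
        refine ⟨d, k1, k2, k3, ?_, k5⟩
        rw [k4]
        simpa using h2.symm
    refine ⟨Function.update d e α, ?_, ?_, ?_, ?_, ?_⟩
    · intro e'; by_cases h : e' = e
      · subst h; simpa using hα
      · rw [Function.update_of_ne h]; exact hd1 e'
    · intro e' h
      rw [List.mem_cons, not_or] at h
      rw [Function.update_of_ne h.1]; exact hd2 e' h.2
    · rw [List.map_cons, hmap, List.isChain_cons]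
      simpa using ⟨by simpa using hd4, hd3⟩
    · simp
    · rw [List.map_cons, hmap, List.getLast?_cons, hd5]; rfl

theorem PP.congr {c' : Sym2 V → ℕ} (h : ∀ u v, G.Adj u v → u ∈ S → v ∈ S → c' s(u, v) = c s(u, v))
    {u v : V} {i j : ℕ} (hp : PP G c S u v i j) : PP G c' S u v i j := by
  obtain ⟨p, h1, h2, h3⟩ := hp
  have : p.edges.map c' = p.edges.map c := by
    apply List.map_congr_left
    intro e he
    induction e with
    | _ a b =>
      exact h a b (p.adj_of_mem_edges he) (h2 _ (p.fst_mem_support_of_mem_edges he))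
        (h2 _ (p.snd_mem_support_of_mem_edges he))
  refine ⟨p, h1, h2, ?_⟩
  rwa [this]

theorem Strong.congr {c' : Sym2 V → ℕ}
    (h : ∀ u v, G.Adj u v → u ∈ S → v ∈ S → c' s(u, v) = c s(u, v))
    (hS : Strong G c S) : Strong G c' S := by
  intro u hu v hv huv
  obtain ⟨i, j, i', j', h1, h2, h3, h4⟩ := hS u hu v hv huv
  exact ⟨i, j, i', j', h1, h2, h3.congr h, h4.congr h⟩

theorem step (hS : Strong G c S) (hc : ∀ e, c e < 3) {a y : V} (ha : a ∈ S) (hy : y ∉ S)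
    (hadj : G.Adj a y) (hb : ¬ G.IsBridge s(a, y)) :
    ∃ (c' : Sym2 V → ℕ) (S' : Set V), (∀ e, c' e < 3) ∧ Strong G c' S' ∧ S ⊆ S' ∧ y ∈ S' := by
  classical
  rw [SimpleGraph.isBridge_iff_forall_walk_mem_edges] at hb
  push Not at hb
  obtain ⟨w, hw⟩ := hb
  -- path from y to S avoiding the edge
  obtain ⟨b, hbS, P, P2, hPP, hPS⟩ := walk_hit S w.reverse.bypass ha
  have hPpath : P.IsPath := by
    have := w.reverse.bypass_isPath
    rw [hPP] at this
    exact this.of_append_left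
  have hPe : s(a, y) ∉ P.edges := by
    intro h
    have h1 : s(a, y) ∈ w.reverse.bypass.edges := by
      rw [hPP, SimpleGraph.Walk.edges_append]; exact List.mem_append_left _ h
    have := w.reverse.edges_bypass_subset h1
    rw [SimpleGraph.Walk.edges_reverse, List.mem_reverse] at this
    exact hw this
  have hPne : P.edges ≠ [] := by
    rw [Ne, SimpleGraph.Walk.edges_eq_nil]
    intro h
    exact hy (h.eq ▸ hbS)
  -- the path back inside S
  obtain ⟨Q, hQ1, hQ2, hQ3⟩ : ∃ Q : G.Walk b a, Q.IsPath ∧ (∀ x ∈ Q.support, x ∈ S) ∧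
      (Q.edges.map c).IsChain (· ≠ ·) := by
    by_cases hba : b = a
    · subst hba
      exact ⟨.nil, by simp, by simpa using hbS, by simp⟩
    · obtain ⟨i, j, i', j', -, -, ⟨Q, h1, h2, h3, -⟩, -⟩ := hS b hbS a ha hba
      exact ⟨Q, h1, h2, h3⟩
  -- end colors
  obtain ⟨α, β, hα, hβ, hαβ, hαQ, hβQ⟩ : ∃ α β, α < 3 ∧ β < 3 ∧ α ≠ β ∧
      (∀ z ∈ (Q.edges.map c).getLast?, z ≠ α) ∧ (∀ z ∈ (Q.edges.map c).head?, β ≠ z) := by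
    have aux : ∀ s t : ℕ, ∃ α β, α < 3 ∧ β < 3 ∧ α ≠ β ∧ s ≠ α ∧ β ≠ t := by
      intro s t
      by_cases h0 : s = 0
      · by_cases h1 : t = 1
        · exact ⟨1, 0, by omega⟩
        · by_cases h2 : t = 2
          · exact ⟨1, 0, by omega⟩
          · exact ⟨1, 2, by omega⟩
      · by_cases h1 : t = 1
        · exact ⟨0, 2, by omega⟩
        · exact ⟨0, 1, by omega⟩
    obtain ⟨α, β, h1, h2, h3, h4, h5⟩ :=
      aux ((Q.edges.map c).getLast?.getD 0) ((Q.edges.map c).head?.getD 0)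
    refine ⟨α, β, h1, h2, h3, ?_, ?_⟩
    · intro z hz
      rw [Option.mem_def] at hz
      rw [hz] at h4; exact h4
    · intro z hz
      rw [Option.mem_def] at hz
      rw [hz] at h5; exact h5
  obtain ⟨c', k1, k2, k3, k4, k5⟩ := color_list (s(a, y) :: P.edges) c α β
    (List.nodup_cons.2 ⟨hPe, hPpath.isTrail.edges_nodup⟩)
    (by have := List.length_pos_of_ne_nil hPne; simp only [List.length_cons]; omega) hc hα hβ hαβ
  have hcong : ∀ u v, G.Adj u v → u ∈ S → v ∈ S → c' s(u, v) = c s(u, v) := by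
    intro u v huv hu hv
    apply k2
    intro hmem
    rw [List.mem_cons] at hmem
    rcases hmem with h | h
    · rw [Sym2.eq_iff] at h
      rcases h with ⟨-, rfl⟩ | ⟨rfl, -⟩
      · exact hy hv
      · exact hy hu
    · have e1 := hPS u (P.fst_mem_support_of_mem_edges h) hu
      have e2 := hPS v (P.snd_mem_support_of_mem_edges h) hv
      exact huv.ne (e1.trans e2.symm)
  have hQmap : Q.edges.map c' = Q.edges.map c := by
    apply List.map_congr_left
    intro e he
    induction e with
    | _ u v =>
      exact hcong u v (Q.adj_of_mem_edges he) (hQ2 _ (Q.fst_mem_support_of_mem_edges he))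
        (hQ2 _ (Q.snd_mem_support_of_mem_edges he))
  have hcyc : (SimpleGraph.Walk.cons hadj (P.append Q)).IsCycle := by
    rw [SimpleGraph.Walk.cons_isCycle_iff]
    refine ⟨isPath_append hPpath hQ1 fun x hx hx' => hPS x hx (hQ2 x hx'), ?_⟩
    rw [SimpleGraph.Walk.edges_append, List.mem_append, not_or]
    exact ⟨hPe, fun h => hy (hQ2 _ (Q.snd_mem_support_of_mem_edges h))⟩
  have hT := strong_cycle (c := c') _ hcyc (by
    rw [List.map_cons] at k3 k4 k5
    have e1 : c' s(a, y) = α := by simpa using k4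
    rw [SimpleGraph.Walk.edges_cons, SimpleGraph.Walk.edges_append, List.map_cons,
      List.map_append, hQmap, Cycle.chain_coe_cons, e1]
    rw [e1] at k3 k5
    rw [show α :: (P.edges.map c' ++ Q.edges.map c ++ [α])
      = (α :: P.edges.map c') ++ (Q.edges.map c ++ [α]) by simp]
    rw [List.isChain_append, List.isChain_append]
    refine ⟨k3, ⟨hQ3, by simp, by simpa using hαQ⟩, ?_⟩
    rw [k5]
    intro x hx z hz
    obtain rfl : β = x := by simpa using hx
    rw [Option.mem_def, List.head?_append] at hz
    cases hq : (Q.edges.map c).head? with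
    | none =>
      rw [hq] at hz
      obtain rfl : α = z := by simpa using hz
      exact hαβ.symm
    | some t =>
      rw [hq] at hz
      obtain rfl : t = z := by simpa using hz
      exact hβQ t hq)
  exact ⟨c', _, k1, (hS.congr hcong).union hT ha (by simp), Set.subset_union_left,
    Or.inr (by simp)⟩

theorem exists_strong [Finite V] (hconn : G.Connected)
    (hb : ∀ e ∈ G.edgeSet, ¬ G.IsBridge e) :
    ∃ c : Sym2 V → ℕ, (∀ e, c e < 3) ∧ Strong G c Set.univ := by
  classical
  obtain ⟨r⟩ := hconn.nonempty
  let F : Set (Set V) := {S | r ∈ S ∧ ∃ c : Sym2 V → ℕ, (∀ e, c e < 3) ∧ Strong G c S}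
  have hF : F.Nonempty := by
    refine ⟨{r}, rfl, fun _ => 0, by simp, ?_⟩
    intro u hu v hv huv
    exact absurd (hu.trans hv.symm) huv
  obtain ⟨S, ⟨hr, c, hc, hS⟩, hmax⟩ := (Set.toFinite F).exists_maximal hF
  suffices h : S = Set.univ by exact ⟨c, hc, h ▸ hS⟩
  by_contra hne
  obtain ⟨t, ht⟩ := (Set.ne_univ_iff_exists_notMem S).1 hne
  obtain ⟨w⟩ := hconn.preconnected r t
  obtain ⟨d, -, h1, h2⟩ := w.exists_boundary_dart S hr ht
  obtain ⟨c', S', g1, g2, g3, g4⟩ := step hS hc h1 h2 d.adj (hb _ d.adj)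
  exact h2 (hmax ⟨g3 hr, c', g1, g2⟩ g3 g4)

end PCAux

theorem stmt1 {V : Type*} [Fintype V] (G : SimpleGraph V)
    (hcard : 2 ≤ Fintype.card V) (hconn : G.Connected)
    (hbridgeless : ∀ e ∈ G.edgeSet, ¬ G.IsBridge e) :
    pc G ≤ 3 ∧ ∃ c : Sym2 V → ℕ, (∀ e ∈ G.edgeSet, c e < 3) ∧
      IsProperPathColoring G c ∧ HasStrongProperty G c := by
  obtain ⟨c, hc, hS⟩ := PCAux.exists_strong hconn hbridgeless
  have hstrong : HasStrongProperty G c := by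
    intro u v huv
    obtain ⟨i, j, i', j', h1, h2, ⟨p, p1, -, p3, p4, p5⟩, ⟨q, q1, -, q3, q4, q5⟩⟩ :=
      hS u trivial v trivial huv
    refine ⟨p, q, p1, q1, (List.isChain_map c).1 p3, (List.isChain_map c).1 q3, ?_, ?_⟩
    · rw [← List.head?_map, ← List.head?_map, p4, q4]
      simpa using h1
    · rw [← List.getLast?_map, ← List.getLast?_map, p5, q5]
      simpa using h2
  have hpp : IsProperPathColoring G c := by
    intro u v huv
    obtain ⟨p, _, h1, _, h2, _⟩ := hstrong u v huv
    exact ⟨p, h1, h2⟩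
  exact ⟨Nat.sInf_le ⟨c, fun e _ => hc e, hpp⟩, c, fun e _ => hc e, hpp, hstrong⟩
end

section
/- If G is a bipartite connected bridgeless graph (a connected bipartite graph with no cut-edges) on at least 2 vertices, then pc(G) ≤ 2; moreover there exists a proper-path coloring c of G using at most 2 colors such that G has the strong property under c. -/
theorem aux_strong_asymm {V : Type*} [Finite V] (G : SimpleGraph V) (hconn : G.Connected)
    (hb : ∀ e ∈ G.edgeSet, ¬ G.IsBridge e) :
    ∃ D : V → V → Prop, (∀ a b, D a b → G.Adj a b) ∧ (∀ a b, D a b → ¬ D b a) ∧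
      (∀ X : Set V, X.Nonempty → (∀ a b, D a b → a ∈ X → b ∈ X) → X = Set.univ) := by
  classical
  let P : Set (Set (V × V)) := {D | (∀ a b, (a, b) ∈ D → G.Adj a b) ∧
    (∀ a b, G.Adj a b → (a, b) ∈ D ∨ (b, a) ∈ D) ∧
    (∀ X : Set V, X.Nonempty → (∀ a b, (a, b) ∈ D → a ∈ X → b ∈ X) → X = Set.univ)}
  have hP : P.Nonempty := by
    refine ⟨{x | G.Adj x.1 x.2}, fun a b h => h, fun a b h => Or.inl h, ?_⟩
    rintro X ⟨x, hx⟩ hX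
    refine Set.eq_univ_of_forall fun y => ?_
    obtain ⟨p⟩ := hconn.preconnected x y
    induction p with
    | nil => exact hx
    | cons h p ih => exact ih (hX _ _ h hx)
  obtain ⟨D, hD⟩ := (Set.toFinite P).exists_minimal hP
  obtain ⟨⟨h1, h2, h3⟩, hmin⟩ := hD
  refine ⟨fun a b => (a, b) ∈ D, h1, ?_, h3⟩
  intro a b hab hba
  have hne : a ≠ b := (h1 a b hab).ne
  -- a cut for each removed arc
  have key : ∀ a b : V, (a, b) ∈ D → (b, a) ∈ D → a ≠ b → ∃ X : Set V, a ∈ X ∧ b ∉ X ∧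
      ∀ x y, (x, y) ∈ D → x ∈ X → y ∉ X → x = a ∧ y = b := by
    intro a b hab hba hne
    by_contra hcon
    have hmem : D \ {(a, b)} ∈ P := by
      refine ⟨fun x y h => h1 x y h.1, ?_, ?_⟩
      · intro x y hxy
        by_cases h : x = a ∧ y = b
        · obtain ⟨rfl, rfl⟩ := h
          exact Or.inr ⟨hba, by simp [hne.symm]⟩
        · by_cases h' : y = a ∧ x = b
          · obtain ⟨rfl, rfl⟩ := h'
            exact Or.inl ⟨hba, by simp [hne.symm]⟩
          · rcases h2 x y hxy with h4 | h4
            · exact Or.inl ⟨h4, by simpa using h⟩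
            · exact Or.inr ⟨h4, by simpa using h'⟩
      · intro X hX hcl
        by_contra hXu
        have hcl' : ∀ x y, (x, y) ∈ D → x ∈ X → y ∉ X → x = a ∧ y = b := by
          intro x y hxy hx hy
          by_contra h
          exact hy (hcl x y ⟨hxy, by simpa using h⟩ hx)
        by_cases hh : a ∈ X ∧ b ∉ X
        · exact hcon ⟨X, hh.1, hh.2, hcl'⟩
        · apply hXu
          apply h3 X hX
          intro x y hxy hx
          by_contra hy
          obtain ⟨rfl, rfl⟩ := hcl' x y hxy hx hy
          exact hh ⟨hx, hy⟩
    have := hmin hmem Set.sdiff_subset hab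
    exact this.2 rfl
  obtain ⟨X, haX, hbX, hX⟩ := key a b hab hba hne
  obtain ⟨Y, hbY, haY, hY⟩ := key b a hba hab hne.symm
  have hdisj : ∀ x, x ∈ X → x ∈ Y → False := by
    intro x hx hy
    have := h3 (X ∩ Y) ⟨x, hx, hy⟩ (by
      rintro u v huv ⟨hu, hu'⟩
      constructor
      · by_contra h
        exact haY ((hX u v huv hu h).1 ▸ hu')
      · by_contra h
        exact hbX ((hY u v huv hu' h).1 ▸ hu))
    have h4 : a ∈ X ∩ Y := this ▸ Set.mem_univ a
    exact haY h4.2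
  have hun : ∀ x, x ∈ X ∨ x ∈ Y := by
    have := h3 (X ∪ Y) ⟨a, Or.inl haX⟩ (by
      rintro u v huv (hu | hu)
      · by_cases h : v ∈ X
        · exact Or.inl h
        · exact Or.inr ((hX u v huv hu h).2 ▸ hbY)
      · by_cases h : v ∈ Y
        · exact Or.inr h
        · exact Or.inl ((hY u v huv hu h).2 ▸ haX))
    intro x
    have h4 : x ∈ X ∪ Y := this ▸ Set.mem_univ x
    exact h4
  have hadj := h1 a b hab
  apply hb s(a, b) hadj
  rw [SimpleGraph.isBridge_iff]
  have hreach : ∀ x y, (G.deleteEdges {s(a, b)}).Reachable x y → x ∈ X → y ∈ X := by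
    rintro x y ⟨p⟩ hx
    induction p with
    | nil => exact hx
    | @cons u v w h p ih =>
      apply ih
      rw [SimpleGraph.deleteEdges_adj] at h
      by_contra hv
      have hvY := (hun v).resolve_left hv
      have huY : u ∉ Y := fun hh => hdisj u hx hh
      apply h.2
      rcases h2 u v h.1 with h4 | h4
      · obtain ⟨rfl, rfl⟩ := hX u v h4 hx hv
        rfl
      · obtain ⟨rfl, rfl⟩ := hY v u h4 hvY huY
        rfl
  exact fun hr => hbX (hreach a b hr haX)

theorem aux_dir {V : Type*} {G : SimpleGraph V} (D : V → V → Prop) (c : Sym2 V → ℕ) (col : V → ℕ)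
    (hc : ∀ a b, D a b → c s(a, b) = col a) (hcol : ∀ a b, D a b → col a ≠ col b)
    {u v : V} (p : G.Walk u v) (hp : ∀ d ∈ p.darts, D d.fst d.snd) :
    ProperWalk c p ∧ (u ≠ v → p.edges.head?.map c = some (col u)) ∧
      (u ≠ v → ∃ k, p.edges.getLast?.map c = some k ∧ k ≠ col v) ∧
      (∀ e ∈ p.edges.head?, c e = col u) ∧
      (∀ e ∈ p.edges.getLast?, c e ≠ col v) := by
  have main : ProperWalk c p ∧ (∀ e ∈ p.edges.head?, c e = col u) ∧
      (∀ e ∈ p.edges.getLast?, c e ≠ col v) := by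
    induction p with
    | nil => exact ⟨List.IsChain.nil, by simp, by simp⟩
    | @cons u v w h p ih =>
      have hD : D u v := hp ⟨(u, v), h⟩ (by simp)
      obtain ⟨i1, i2, i3⟩ := ih (fun d hd => hp d (by simp [hd]))
      refine ⟨?_, ?_, ?_⟩
      · unfold ProperWalk at *
        rw [SimpleGraph.Walk.edges_cons]
        refine List.isChain_cons.2 ⟨?_, i1⟩
        intro e he
        rw [hc _ _ hD, i2 e he]
        exact hcol _ _ hD
      · simp [hc _ _ hD]
      · intro e he
        cases p with
        | nil =>
          simp at he
          subst he
          rw [hc _ _ hD]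
          exact hcol _ _ hD
        | cons h' p' =>
          apply i3
          simpa [List.getLast?_cons_cons] using he
  obtain ⟨m1, m2, m3⟩ := main
  refine ⟨m1, ?_, ?_, m2, m3⟩
  · intro hne
    cases p with
    | nil => exact absurd rfl hne
    | cons h p => simpa using m2
  · intro hne
    cases hl : p.edges.getLast? with
    | none =>
      cases p with
      | nil => exact absurd rfl hne
      | cons h p => simp at hl
    | some e => exact ⟨c e, rfl, m3 e hl⟩

theorem stmt2 {V : Type*} [Fintype V] (G : SimpleGraph V)
    (hcard : 2 ≤ Fintype.card V) (hconn : G.Connected)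
    (hbip : ∃ s : Set V, ∀ a b : V, G.Adj a b → (a ∈ s ↔ b ∉ s))
    (hbridgeless : ∀ e ∈ G.edgeSet, ¬ G.IsBridge e) :
    pc G ≤ 2 ∧ ∃ c : Sym2 V → ℕ, (∀ e ∈ G.edgeSet, c e < 2) ∧
      IsProperPathColoring G c ∧ HasStrongProperty G c := by
  classical
  obtain ⟨s, hs⟩ := hbip
  obtain ⟨D, hD1, hD2, hD3⟩ := aux_strong_asymm G hconn hbridgeless
  have hpath : ∀ u v, ∃ p : G.Walk u v, p.IsPath ∧ ∀ d ∈ p.darts, D d.fst d.snd := by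
    intro u v
    have := hD3 {w | ∃ p : G.Walk u w, ∀ d ∈ p.darts, D d.fst d.snd} ⟨u, .nil, by simp⟩ (by
      rintro a b hab ⟨p, hp⟩
      refine ⟨p.concat (hD1 a b hab), ?_⟩
      intro d hd
      rw [SimpleGraph.Walk.darts_concat] at hd
      simp at hd
      rcases hd with hd | rfl
      · exact hp d hd
      · exact hab)
    have hv : v ∈ {w | ∃ p : G.Walk u w, ∀ d ∈ p.darts, D d.fst d.snd} := this ▸ Set.mem_univ v
    obtain ⟨p, hp⟩ := hv
    exact ⟨p.bypass, p.bypass_isPath, fun d hd => hp d (p.darts_bypass_subset_darts hd)⟩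
  let col : V → ℕ := fun x => if x ∈ s then 0 else 1
  let c : Sym2 V → ℕ := fun e => if ∃ a b, e = s(a, b) ∧ D a b ∧ a ∈ s then 0 else 1
  have hcol2 : ∀ x, col x < 2 := by
    intro x; simp only [col]; split_ifs <;> omega
  have hc : ∀ a b, D a b → c s(a, b) = col a := by
    intro a b hab
    by_cases ha : a ∈ s
    · have : ∃ a' b', s(a, b) = s(a', b') ∧ D a' b' ∧ a' ∈ s := ⟨a, b, rfl, hab, ha⟩
      simp only [c, col, if_pos this, if_pos ha]
    · have : ¬ ∃ a' b', s(a, b) = s(a', b') ∧ D a' b' ∧ a' ∈ s := by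
        rintro ⟨a', b', he, hd, ha'⟩
        rcases Sym2.eq_iff.1 he with ⟨rfl, rfl⟩ | ⟨rfl, rfl⟩
        · exact ha ha'
        · exact hD2 _ _ hab hd
      simp only [c, col, if_neg this, if_neg ha]
  have hcol : ∀ a b, D a b → col a ≠ col b := by
    intro a b hab
    have := hs a b (hD1 a b hab)
    by_cases hb : b ∈ s <;> simp [col, hb, this]
  have hc2 : ∀ e ∈ G.edgeSet, c e < 2 := by
    intro e _; simp only [c]; split_ifs <;> omega
  have hproper : IsProperPathColoring G c := by
    intro u v _
    obtain ⟨p, hp, hd⟩ := hpath u v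
    exact ⟨p, hp, (aux_dir D c col hc hcol p hd).1⟩
  refine ⟨Nat.sInf_le ⟨c, hc2, hproper⟩, c, hc2, hproper, ?_⟩
  intro u v huv
  obtain ⟨p, hp, hd⟩ := hpath u v
  obtain ⟨q, hq, hdq⟩ := hpath v u
  obtain ⟨p1, p2, p3, -⟩ := aux_dir D c col hc hcol p hd
  obtain ⟨q1, q2, q3, -⟩ := aux_dir D c col hc hcol q hdq
  obtain ⟨k, hk, hk'⟩ := p3 huv
  obtain ⟨l, hl, hl'⟩ := q3 huv.symm
  refine ⟨p, q.reverse, hp, hq.reverse, p1, ?_, ?_, ?_⟩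
  · unfold ProperWalk at q1 ⊢
    rw [SimpleGraph.Walk.edges_reverse]
    refine List.isChain_reverse.2 ?_
    refine List.IsChain.imp ?_ q1
    intro a b h
    exact h.symm
  · rw [SimpleGraph.Walk.edges_reverse, List.head?_reverse, p2 huv, hl]
    simpa using hl'.symm
  · rw [SimpleGraph.Walk.edges_reverse, List.getLast?_reverse, hk, q2 huv.symm]
    simpa using hk'
end

section
/- Let G be a connected Eulerian graph (every vertex has even degree) on at least 3 vertices. Then pc(G) ≤ 3. Furthermore, if G is in addition bipartite, then pc(G) = 2. -/
open SimpleGraph in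
theorem aux_not_bridge {V : Type*} [Fintype V] [DecidableEq V] (G : SimpleGraph V)
    [DecidableRel G.Adj] (heuler : ∀ v : V, Even (G.degree v)) {x w : V} (h : G.Adj x w) :
    ∃ p : G.Walk w x, p.IsPath ∧ s(x, w) ∉ p.edges := by
  classical
  have key : (G.deleteEdges {s(w, x)}).Reachable w x := by
    by_contra hr
    let D := G.deleteEdges {s(w, x)}
    let H : SimpleGraph V :=
      { Adj := fun a b => D.Adj a b ∧ D.Reachable w a
        symm := ⟨fun a b hab => ⟨hab.1.symm, hab.2.trans hab.1.reachable⟩⟩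
        loopless := ⟨fun a ha => D.loopless.irrefl a ha.1⟩ }
    have hD : ∀ a b, D.Adj a b ↔ G.Adj a b ∧ s(a, b) ≠ s(w, x) := by
      intro a b; simp [D, SimpleGraph.deleteEdges_adj]
    have hw : Odd (H.degree w) := by
      have : H.neighborFinset w = (G.neighborFinset w).erase x := by
        ext b
        simp only [SimpleGraph.mem_neighborFinset, Finset.mem_erase, H, hD]
        have : D.Reachable w w := Reachable.refl _
        constructor
        · rintro ⟨⟨h1, h2⟩, -⟩
          exact ⟨fun hb => h2 (by rw [hb]), h1⟩
        · rintro ⟨h1, h2⟩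
          refine ⟨⟨h2, ?_⟩, this⟩
          intro hs
          simp at hs
          grind
      rw [← SimpleGraph.card_neighborFinset_eq_degree, this, Finset.card_erase_of_mem (by simpa using h.symm),
        SimpleGraph.card_neighborFinset_eq_degree]
      have h1 := heuler w
      have h2 : 0 < G.degree w := (G.degree_pos_iff_exists_adj w).2 ⟨x, h.symm⟩
      grind
    obtain ⟨a, ha, hodd⟩ := H.exists_ne_odd_degree_of_exists_odd_degree w hw
    by_cases hra : D.Reachable w a
    · have hax : a ≠ x := by rintro rfl; exact hr hra
      have : H.neighborFinset a = G.neighborFinset a := by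
        ext b
        simp only [SimpleGraph.mem_neighborFinset, H, hD]
        constructor
        · exact fun h => h.1.1
        · intro h
          refine ⟨⟨h, ?_⟩, hra⟩
          intro hs
          simp at hs
          grind
      rw [← SimpleGraph.card_neighborFinset_eq_degree, this,
        SimpleGraph.card_neighborFinset_eq_degree] at hodd
      exact Nat.not_even_iff_odd.2 hodd (heuler a)
    · have : H.neighborFinset a = ∅ := by
        ext b
        simp [H, hra]
      rw [← SimpleGraph.card_neighborFinset_eq_degree, this] at hodd
      simp at hodd
  obtain ⟨p, hp⟩ := SimpleGraph.reachable_deleteEdges_iff_exists_walk.1 key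
  refine ⟨p.bypass, p.bypass_isPath, fun hmem => hp ?_⟩
  rw [Sym2.eq_swap]
  exact p.edges_bypass_subset_edges hmem

def AuxStrong {V : Type*} (G : SimpleGraph V) (c : Sym2 V → ℕ) (S : Set V) : Prop :=
  ∀ u ∈ S, ∀ v ∈ S, u ≠ v → ∀ a : ℕ, ∃ p : G.Walk u v, p.IsPath ∧
    (p.edges.map c).IsChain (· ≠ ·) ∧ (∀ z ∈ p.support, z ∈ S) ∧
    (p.edges.map c).head? ≠ some a

theorem aux_first_hit {V : Type*} {G : SimpleGraph V} (S : Set V) {u v : V} (p : G.Walk u v)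
    (hv : v ∈ S) : ∃ (x : V) (q : G.Walk u x) (r : G.Walk x v), p = q.append r ∧ x ∈ S ∧
      ∀ z ∈ q.support, z ∈ S → z = x := by
  induction p with
  | nil => exact ⟨_, .nil, .nil, rfl, hv, by simp⟩
  | @cons a b d h p ih =>
    by_cases ha : a ∈ S
    · exact ⟨a, .nil, .cons h p, rfl, ha, by simp⟩
    · obtain ⟨x, q, r, h1, h2, h3⟩ := ih hv
      refine ⟨x, .cons h q, r, by simp [h1], h2, ?_⟩
      intro z hz hzS
      rw [SimpleGraph.Walk.support_cons, List.mem_cons] at hz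
      rcases hz with rfl | hz
      · exact absurd hzS ha
      · exact h3 z hz hzS

theorem aux_append_path {V : Type*} {G : SimpleGraph V} {u x v : V} (q : G.Walk u x)
    (s : G.Walk x v) (hq : q.IsPath) (hs : s.IsPath)
    (h : ∀ z ∈ q.support, z ∈ s.support → z = x) : (q.append s).IsPath := by
  rw [SimpleGraph.Walk.isPath_def] at *
  rw [SimpleGraph.Walk.support_append]
  have hs2 := hs
  rw [← SimpleGraph.Walk.cons_tail_support, List.nodup_cons] at hs2
  rw [List.nodup_append]
  refine ⟨hq, hs2.2, ?_⟩
  rintro a ha b hb rfl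
  have := h a ha (List.mem_of_mem_tail hb)
  subst this
  exact hs2.1 hb

theorem aux_union_half {V : Type*} {G : SimpleGraph V} {c : Sym2 V → ℕ} {S T : Set V}
    (hS : AuxStrong G c S) (hT : AuxStrong G c T) (z : V) (hzS : z ∈ S) (hzT : z ∈ T)
    (u v : V) (hu : u ∈ T) (hu' : u ∉ S) (hv : v ∈ S) (hv' : v ∉ T) (a : ℕ) :
    ∃ p : G.Walk u v, p.IsPath ∧
    (p.edges.map c).IsChain (· ≠ ·) ∧ (∀ z ∈ p.support, z ∈ S ∪ T) ∧
    (p.edges.map c).head? ≠ some a := by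
  obtain ⟨p, hp1, hp2, hp3, hp4⟩ := hT u hu z hzT (by grind) a
  obtain ⟨x, q, r, rfl, hx, hq⟩ := aux_first_hit S p hzS
  have hxT : x ∈ T := hp3 x (by simp)
  have hux : u ≠ x := by grind
  have hne : q.edges.map c ≠ [] := by
    cases q with
    | nil => exact absurd rfl hux
    | cons h q => simp
  obtain ⟨b, hb⟩ : ∃ b, (q.edges.map c).getLast? = some b := by
    rw [← Option.isSome_iff_exists]; simpa using hne
  obtain ⟨s, hs1, hs2, hs3, hs4⟩ := hS x hx v hv (by grind) b
  rw [SimpleGraph.Walk.edges_append, List.map_append, List.isChain_append] at hp2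
  rw [SimpleGraph.Walk.edges_append, List.map_append, List.head?_append_of_ne_nil _ hne] at hp4
  refine ⟨q.append s, aux_append_path q s hp1.of_append_left hs1 ?_, ?_, ?_, ?_⟩
  · intro y hy hy'
    exact hq y hy (hs3 y hy')
  · rw [SimpleGraph.Walk.edges_append, List.map_append, List.isChain_append]
    refine ⟨hp2.1, hs2, ?_⟩
    intro d hd e he hde
    rw [Option.mem_def] at hd he
    rw [hb] at hd
    cases hd
    exact hs4 (hde ▸ he)
  · intro y hy
    rw [SimpleGraph.Walk.mem_support_append_iff] at hy
    rcases hy with hy | hy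
    · exact Or.inr (hp3 y (by rw [SimpleGraph.Walk.mem_support_append_iff]; exact Or.inl hy))
    · exact Or.inl (hs3 y hy)
  · rw [SimpleGraph.Walk.edges_append, List.map_append, List.head?_append_of_ne_nil _ hne]
    exact hp4

theorem aux_union {V : Type*} {G : SimpleGraph V} {c : Sym2 V → ℕ} {S T : Set V}
    (hS : AuxStrong G c S) (hT : AuxStrong G c T) (z : V) (hzS : z ∈ S) (hzT : z ∈ T) :
    AuxStrong G c (S ∪ T) := by
  intro u hu v hv huv a
  by_cases h1 : u ∈ S ∧ v ∈ S
  · obtain ⟨p, a1, a2, a3, a4⟩ := hS u h1.1 v h1.2 huv a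
    exact ⟨p, a1, a2, fun z hz => Or.inl (a3 z hz), a4⟩
  by_cases h2 : u ∈ T ∧ v ∈ T
  · obtain ⟨p, a1, a2, a3, a4⟩ := hT u h2.1 v h2.2 huv a
    exact ⟨p, a1, a2, fun z hz => Or.inr (a3 z hz), a4⟩
  by_cases h3 : u ∈ S
  · rw [Set.union_comm]
    exact aux_union_half hT hS z hzT hzS u v h3 (by grind) (by grind) (by grind) a
  · exact aux_union_half hS hT z hzS hzT u v (by grind) (by grind) (by grind) (by grind) a

theorem aux_cycle {V : Type*} {G : SimpleGraph V} {c : Sym2 V → ℕ} {x : V} (C : G.Walk x x)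
    (hC : C.IsCycle) (hch : Cycle.Chain (· ≠ ·) ((C.edges.map c : List ℕ) : Cycle ℕ)) :
    AuxStrong G c {z | z ∈ C.support} := by
  classical
  intro u hu v hv huv a
  change u ∈ C.support at hu
  change v ∈ C.support at hv
  have hR : (C.rotate u hu).IsCycle := hC.rotate hu
  have hRch : Cycle.Chain (· ≠ ·) (((C.rotate u hu).edges.map c : List ℕ) : Cycle ℕ) := by
    have : (((C.rotate u hu).edges.map c : List ℕ) : Cycle ℕ) = (C.edges.map c : List ℕ) :=
      Quotient.sound ((C.rotate_edges u hu).map c)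
    rwa [this]
  have hRs : ∀ z, z ∈ (C.rotate u hu).support → z ∈ C.support := by
    intro z hz
    simpa using hz
  have hvR : v ∈ (C.rotate u hu).support := by simpa using hv
  generalize C.rotate u hu = R at *
  have hspec := R.take_spec hvR
  generalize R.takeUntil v hvR = p at *
  generalize R.dropUntil v hvR = q at *
  subst hspec
  have hpn : ¬ p.Nil := SimpleGraph.Walk.not_nil_of_ne huv
  have hqn : ¬ q.Nil := SimpleGraph.Walk.not_nil_of_ne huv.symm
  have hp := hR.isPath_of_append_left hqn
  have hq := hR.isPath_of_append_right hpn
  have e1 : p.edges.map c ≠ [] := by simpa using hpn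
  have e2 : q.edges.map c ≠ [] := by simpa using hqn
  have s1 : ∀ z ∈ p.support, z ∈ C.support := fun z hz => hRs z (by
    rw [SimpleGraph.Walk.mem_support_append_iff]; exact Or.inl hz)
  have s2 : ∀ z ∈ q.support, z ∈ C.support := fun z hz => hRs z (by
    rw [SimpleGraph.Walk.mem_support_append_iff]; exact Or.inr hz)
  rw [SimpleGraph.Walk.edges_append, List.map_append,
    Cycle.chain_ne_nil _ (by simp [hpn, hqn]), List.getLast_append_of_ne_nil _ e2] at hRch
  have c0 := hRch.tail
  simp only [List.tail_cons] at c0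
  rw [List.isChain_append] at c0
  by_cases hpa : (p.edges.map c).head? = some a
  · refine ⟨q.reverse, hq.reverse, ?_, ?_, ?_⟩
    · rw [SimpleGraph.Walk.edges_reverse, List.map_reverse, List.isChain_reverse]
      exact c0.2.1.imp fun _ _ h => h.symm
    · intro z hz
      exact s2 z (by simpa using hz)
    · rw [SimpleGraph.Walk.edges_reverse, List.map_reverse, List.head?_reverse,
        List.getLast?_eq_getLast_of_ne_nil e2]
      intro h
      rw [Option.some_inj] at h
      rw [h] at hRch
      cases hl : p.edges.map c with
      | nil => exact e1 hl
      | cons b l =>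
        rw [hl] at hRch hpa
        simp at hRch hpa
        exact hRch.1 hpa.symm
  · exact ⟨p, hp, c0.1, s1, hpa⟩

theorem aux_ext3 (p : List ℕ) (hne : p ≠ []) (hp : p.IsChain (· ≠ ·)) (m : ℕ) :
    ∃ (a : ℕ) (l : List ℕ), l.length = m ∧ (∀ b ∈ a :: l, b < 3) ∧
      (a :: l ++ p).IsChain (· ≠ ·) ∧ a ≠ p.getLast hne := by
  have pick : ∀ x y : ℕ, ∃ a < 3, a ≠ x ∧ a ≠ y := by
    intro x y
    by_cases h0 : 0 ≠ x ∧ 0 ≠ y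
    · exact ⟨0, by omega, h0⟩
    by_cases h1 : 1 ≠ x ∧ 1 ≠ y
    · exact ⟨1, by omega, h1⟩
    · exact ⟨2, by omega, by omega, by omega⟩
  induction m with
  | zero =>
    obtain ⟨b, p', rfl⟩ := List.exists_cons_of_ne_nil hne
    obtain ⟨a, h1, h2, h3⟩ := pick b ((b :: p').getLast hne)
    refine ⟨a, [], rfl, by simpa using h1, ?_, h3⟩
    simp only [List.cons_append, List.nil_append, List.isChain_cons_cons]
    exact ⟨h2, hp⟩
  | succ m ih =>
    obtain ⟨b, l, e1, e2, e3, e4⟩ := ih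
    obtain ⟨a, h1, h2, h3⟩ := pick b (p.getLast hne)
    refine ⟨a, b :: l, by simp [e1], ?_, ?_, h3⟩
    · intro d hd
      rcases List.mem_cons.1 hd with rfl | hd
      · exact h1
      · exact e2 d hd
    · simp only [List.cons_append, List.isChain_cons_cons] at e3 ⊢
      exact ⟨h2, e3⟩

theorem aux_ext2 (p : List ℕ) (hp : p.IsChain (· ≠ ·)) (hlt : ∀ b ∈ p, b < 2) (m : ℕ) :
    ∃ l : List ℕ, l.length = m ∧ (∀ b ∈ l ++ p, b < 2) ∧ (l ++ p).IsChain (· ≠ ·) := by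
  induction m with
  | zero => exact ⟨[], rfl, by simpa using hlt, by simpa using hp⟩
  | succ m ih =>
    obtain ⟨l, e1, e2, e3⟩ := ih
    cases h : l ++ p with
    | nil =>
      refine ⟨0 :: l, by simp [e1], ?_, ?_⟩
      · rw [List.cons_append, h]; simp
      · rw [List.cons_append, h]; simp
    | cons b q =>
      refine ⟨(1 - b) :: l, by simp [e1], ?_, ?_⟩
      · intro d hd
        rw [List.cons_append] at hd
        rcases List.mem_cons.1 hd with rfl | hd
        · omega
        · exact e2 d hd
      · have hb : b < 2 := e2 b (by rw [h]; simp)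
        rw [h] at e3
        rw [List.cons_append, h, List.isChain_cons_cons]
        exact ⟨by omega, e3⟩

theorem aux_last2 (l : List ℕ) : ∀ a : ℕ, (a :: l).IsChain (· ≠ ·) → (∀ b ∈ a :: l, b < 2) →
    (a :: l).getLast (by simp) = (a + l.length) % 2 := by
  induction l with
  | nil => intro a _ h; have := h a (by simp); simp; omega
  | cons b l ih =>
    intro a h1 h2
    rw [List.isChain_cons_cons] at h1
    have h3 := ih b h1.2 (fun d hd => h2 d (List.mem_cons_of_mem _ hd))
    rw [List.getLast_cons (by simp), h3, List.length_cons]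
    have := h2 a (by simp)
    have := h2 b (by simp)
    have := h1.1
    omega

theorem aux_color (k : ℕ) (p : List ℕ) (hp : p.IsChain (· ≠ ·)) (hlt : ∀ b ∈ p, b < k) (m : ℕ)
    (hm : 2 ≤ m) (hk : k = 3 ∨ (k = 2 ∧ Even (m + p.length))) :
    ∃ l : List ℕ, l.length = m ∧ (∀ b ∈ l, b < k) ∧
      Cycle.Chain (· ≠ ·) ((l ++ p : List ℕ) : Cycle ℕ) := by
  rcases hk with rfl | ⟨rfl, hev⟩
  · by_cases hne : p = []
    · subst hne
      obtain ⟨a, l, h1, h2, h3, h4⟩ := aux_ext3 [0] (by simp) (by simp) (m - 2)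
      refine ⟨a :: l ++ [0], by simp [h1]; omega, ?_, ?_⟩
      · intro b hb
        rw [List.mem_append] at hb
        rcases hb with hb | hb
        · exact h2 b hb
        · simp at hb; omega
      · rw [List.append_nil, Cycle.chain_ne_nil _ (by simp)]
        rw [List.getLast_append_of_ne_nil _ (by simp)]
        simp only [List.cons_append, List.isChain_cons_cons] at h3 ⊢
        exact ⟨h4.symm, h3⟩
    · obtain ⟨a, l, h1, h2, h3, h4⟩ := aux_ext3 p hne hp (m - 1)
      refine ⟨a :: l, by simp [h1]; omega, h2, ?_⟩
      rw [Cycle.chain_ne_nil _ (by simp)]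
      rw [List.getLast_append_of_ne_nil _ hne]
      simp only [List.cons_append, List.isChain_cons_cons] at h3 ⊢
      exact ⟨h4.symm, h3⟩
  · obtain ⟨l, h1, h2, h3⟩ := aux_ext2 p hp hlt m
    refine ⟨l, h1, fun b hb => h2 b (by simp [hb]), ?_⟩
    have hlen : Even (l ++ p).length := by rw [List.length_append, h1]; exact hev
    cases h : l ++ p with
    | nil => simp
    | cons a q =>
      rw [h] at h2 h3 hlen
      rw [Cycle.chain_ne_nil _ (by simp), List.isChain_cons_cons]
      refine ⟨?_, h3⟩
      rw [aux_last2 q a h3 h2]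
      have := h2 a (by simp)
      rw [List.length_cons] at hlen
      grind

theorem aux_recolor {E : Type*} [DecidableEq E] (c : E → ℕ) (k : ℕ) (hc : ∀ e, c e < k)
    (L : List E) : ∀ (l : List ℕ), L.Nodup → l.length = L.length → (∀ b ∈ l, b < k) →
    ∃ c' : E → ℕ, (∀ e, c' e < k) ∧ L.map c' = l ∧ ∀ e ∉ L, c' e = c e := by
  induction L with
  | nil =>
    intro l _ h _
    exact ⟨c, hc, by simpa using (List.length_eq_zero_iff.1 h).symm, fun _ _ => rfl⟩
  | cons f L ih =>
    intro l hnd hl hlt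
    cases l with
    | nil => simp at hl
    | cons b l =>
      rw [List.nodup_cons] at hnd
      obtain ⟨c', h1, h2, h3⟩ := ih l hnd.2 (by simpa using hl)
        (fun d hd => hlt d (List.mem_cons_of_mem _ hd))
      refine ⟨Function.update c' f b, ?_, ?_, ?_⟩
      · intro e
        by_cases he : e = f
        · subst he; simpa using hlt b (by simp)
        · simpa [he] using h1 e
      · rw [List.map_cons, Function.update_self, List.cons.injEq]
        refine ⟨rfl, ?_⟩
        rw [← h2]
        apply List.map_congr_left
        intro e he
        have : e ≠ f := by rintro rfl; exact hnd.1 he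
        simp [this]
      · intro e he
        rw [List.mem_cons, not_or] at he
        rw [Function.update_of_ne he.1]
        exact h3 e he.2

theorem aux_step {V : Type*} [DecidableEq V] {G : SimpleGraph V} {c : Sym2 V → ℕ} {k : ℕ}
    (hk : k = 3 ∨ (k = 2 ∧ ∀ (v : V) (p : G.Walk v v), Even p.length))
    {S : Set V} (hS : AuxStrong G c S) (hc : ∀ e, c e < k) {x w : V} (hx : x ∈ S) (hw : w ∉ S)
    (hxw : G.Adj x w) (R : G.Walk w x) (hR : R.IsPath) (hRe : s(x, w) ∉ R.edges) :
    ∃ (c' : Sym2 V → ℕ) (T : Set V), (∀ e, c' e < k) ∧ AuxStrong G c' (S ∪ T) ∧ w ∈ T := by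
  obtain ⟨y, Q, R', rfl, hy, hQ⟩ := aux_first_hit S R hx
  have hQp : Q.IsPath := hR.of_append_left
  have hQe : s(x, w) ∉ Q.edges := fun h => hRe (by
    rw [SimpleGraph.Walk.edges_append]; exact List.mem_append_left _ h)
  obtain ⟨P, hP1, hP2, hP3⟩ : ∃ P : G.Walk y x, P.IsPath ∧ (P.edges.map c).IsChain (· ≠ ·) ∧
      (∀ z ∈ P.support, z ∈ S) := by
    by_cases hyx : y = x
    · subst hyx
      exact ⟨.nil, by simp, by simp, by simpa using hy⟩
    · obtain ⟨P, h1, h2, h3, _⟩ := hS y hy x hx hyx 0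
      exact ⟨P, h1, h2, h3⟩
  have hQP : (Q.append P).IsPath := aux_append_path Q P hQp hP1
    (fun z hz hz' => hQ z hz (hP3 z hz'))
  have hPe : ∀ {a b : V} (W : G.Walk a b), (∀ z ∈ W.support, z ∈ S) → ∀ e ∈ W.edges,
      ∀ z ∈ e, z ∈ S := by
    intro a b W hW e he z hz
    exact hW z (SimpleGraph.Walk.mem_support_of_mem_edges he hz)
  have hcyc : (SimpleGraph.Walk.cons hxw (Q.append P)).IsCycle := by
    rw [SimpleGraph.Walk.cons_isCycle_iff]
    refine ⟨hQP, ?_⟩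
    rw [SimpleGraph.Walk.edges_append, List.mem_append, not_or]
    exact ⟨hQe, fun h => hw (hPe P hP3 _ h w (by simp))⟩
  -- the new edges
  have hQout : ∀ e ∈ s(x, w) :: Q.edges, ∃ z ∈ e, z ∉ S := by
    intro e he
    rcases List.mem_cons.1 he with rfl | he
    · exact ⟨w, by simp, hw⟩
    · induction e with | h a b =>
      by_contra hcon
      push Not at hcon
      have ha := hQ a (Q.fst_mem_support_of_mem_edges he) (hcon a (by simp))
      have hb := hQ b (Q.snd_mem_support_of_mem_edges he) (hcon b (by simp))
      exact (Q.adj_of_mem_edges he).ne (ha.trans hb.symm)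
  have hQlen : 1 ≤ Q.length := by
    rcases Nat.eq_zero_or_pos Q.length with h | h
    · exact absurd (SimpleGraph.Walk.eq_of_length_eq_zero h) (by rintro rfl; exact hw hy)
    · exact h
  obtain ⟨l, l1, l2, l3⟩ := aux_color k (P.edges.map c) hP2
    (by intro b hb; obtain ⟨e, _, rfl⟩ := List.mem_map.1 hb; exact hc e) (Q.length + 1) (by omega)
    (by
      rcases hk with h | ⟨h, h'⟩
      · exact Or.inl h
      · refine Or.inr ⟨h, ?_⟩
        have := h' x (SimpleGraph.Walk.cons hxw (Q.append P))
        simp only [SimpleGraph.Walk.length_cons, SimpleGraph.Walk.length_append] at this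
        simp only [List.length_map, SimpleGraph.Walk.length_edges]
        convert this using 1
        omega)
  obtain ⟨c', d1, d2, d3⟩ := aux_recolor c k hc (s(x, w) :: Q.edges) l
    (List.nodup_cons.2 ⟨hQe, hQp.isTrail.edges_nodup⟩)
    (by simp [l1]) l2
  have hsame : ∀ {a b : V} (W : G.Walk a b), (∀ z ∈ W.support, z ∈ S) →
      W.edges.map c' = W.edges.map c := by
    intro a b W hW
    apply List.map_congr_left
    intro e he
    apply d3
    intro he'
    obtain ⟨z, hz, hzS⟩ := hQout e he'
    exact hzS (hPe W hW e he z hz)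
  have hS' : AuxStrong G c' S := by
    intro u hu v hv huv a
    obtain ⟨p, h1, h2, h3, h4⟩ := hS u hu v hv huv a
    refine ⟨p, h1, ?_, h3, ?_⟩
    · rw [hsame p h3]; exact h2
    · rw [hsame p h3]; exact h4
  have hT := aux_cycle (c := c') _ hcyc (by
    rw [SimpleGraph.Walk.edges_cons, SimpleGraph.Walk.edges_append, ← List.cons_append,
      List.map_append, d2, hsame P hP3]
    exact l3)
  refine ⟨c', _, d1, aux_union hS' hT x hx ?_, ?_⟩
  · exact SimpleGraph.Walk.start_mem_support _
  · change w ∈ SimpleGraph.Walk.support _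
    simp

theorem aux_crossing {V : Type*} {G : SimpleGraph V} (S : Set V) {u v : V} (p : G.Walk u v)
    (hu : u ∈ S) (hv : v ∉ S) : ∃ x w, x ∈ S ∧ w ∉ S ∧ G.Adj x w := by
  induction p with
  | nil => exact absurd hu hv
  | @cons a b d h p ih =>
    by_cases hb : b ∈ S
    · exact ih hb hv
    · exact ⟨a, b, hu, hb, h⟩

theorem aux_main {V : Type*} [Fintype V] [DecidableEq V] {G : SimpleGraph V}
    [DecidableRel G.Adj] (hconn : G.Connected) (heuler : ∀ v : V, Even (G.degree v)) {k : ℕ}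
    (hk : k = 3 ∨ (k = 2 ∧ ∀ (v : V) (p : G.Walk v v), Even p.length)) :
    ∃ c : Sym2 V → ℕ, (∀ e, c e < k) ∧ AuxStrong G c Set.univ := by
  have key : ∀ (n : ℕ) (S : Set V) (c : Sym2 V → ℕ), Sᶜ.ncard = n → S.Nonempty →
      (∀ e, c e < k) → AuxStrong G c S →
      ∃ c : Sym2 V → ℕ, (∀ e, c e < k) ∧ AuxStrong G c Set.univ := by
    intro n
    induction n using Nat.strong_induction_on with
    | _ n ih =>
      intro S c hn hne hc hS
      by_cases hu : S = Set.univ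
      · subst hu; exact ⟨c, hc, hS⟩
      · obtain ⟨v, hv⟩ := (Set.ne_univ_iff_exists_notMem S).1 hu
        obtain ⟨u, hu⟩ := hne
        obtain ⟨p⟩ := hconn.preconnected u v
        obtain ⟨x, w, hx, hw, hxw⟩ := aux_crossing S p hu hv
        obtain ⟨R, hR, hRe⟩ := aux_not_bridge G heuler hxw
        obtain ⟨c', T, h1, h2, h3⟩ := aux_step hk hS hc hx hw hxw R hR hRe
        refine ih _ ?_ (S ∪ T) c' rfl ⟨u, Or.inl hu⟩ h1 h2
        rw [← hn]
        apply Set.ncard_lt_ncard _ (Set.toFinite _)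
        refine ⟨Set.compl_subset_compl.2 Set.subset_union_left, fun h => ?_⟩
        exact (h (show w ∈ Sᶜ from hw)) (Or.inr h3)
  obtain ⟨v⟩ := hconn.nonempty
  refine key _ {v} (fun _ => 0) rfl ⟨v, rfl⟩ (fun _ => by omega) ?_
  intro a ha b hb hab
  exact absurd (Eq.trans ha (Eq.symm hb)) hab

theorem aux_mem {V : Type*} [Fintype V] [DecidableEq V] {G : SimpleGraph V}
    [DecidableRel G.Adj] (hconn : G.Connected) (heuler : ∀ v : V, Even (G.degree v)) {k : ℕ}
    (hk : k = 3 ∨ (k = 2 ∧ ∀ (v : V) (p : G.Walk v v), Even p.length)) :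
    k ∈ {k | ∃ c : Sym2 V → ℕ, (∀ e ∈ G.edgeSet, c e < k) ∧ IsProperPathColoring G c} := by
  obtain ⟨c, h1, h2⟩ := aux_main hconn heuler hk
  refine ⟨c, fun e _ => h1 e, ?_⟩
  intro u v huv
  obtain ⟨p, a1, a2, _⟩ := h2 u trivial v trivial huv 0
  refine ⟨p, a1, ?_⟩
  exact (List.isChain_map c).1 a2

theorem stmt3 {V : Type*} [Fintype V] [DecidableEq V] (G : SimpleGraph V)
    [DecidableRel G.Adj]
    (hcard : 3 ≤ Fintype.card V) (hconn : G.Connected)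
    (heuler : ∀ v : V, Even (G.degree v)) :
    pc G ≤ 3 ∧
      ((∃ s : Set V, ∀ a b : V, G.Adj a b → (a ∈ s ↔ b ∉ s)) → pc G = 2) := by
  refine ⟨Nat.sInf_le (aux_mem hconn heuler (Or.inl rfl)), ?_⟩
  rintro ⟨s, hs⟩
  have hev : ∀ (v : V) (p : G.Walk v v), Even p.length := by
    have : ∀ (u v : V) (p : G.Walk u v), (Even p.length ↔ (u ∈ s ↔ v ∈ s)) := by
      intro u v p
      induction p with
      | nil => simp
      | @cons a b d h p ih =>
        have := hs a b h
        rw [SimpleGraph.Walk.length_cons, Nat.even_add_one, ih]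
        tauto
    intro v p
    exact (this v v p).2 Iff.rfl
  have hmem := aux_mem hconn heuler (Or.inr ⟨rfl, hev⟩)
  apply le_antisymm (Nat.sInf_le hmem)
  apply le_csInf ⟨2, hmem⟩
  rintro k ⟨c, hc, hpp⟩
  by_contra hk
  have hadj : ∀ u v, u ≠ v → G.Adj u v := by
    intro u v huv
    obtain ⟨p, _, hp⟩ := hpp u v huv
    cases p with
    | nil => exact absurd rfl huv
    | cons h q =>
      cases q with
      | nil => exact h
      | cons h' q =>
        unfold ProperWalk at hp
        simp only [SimpleGraph.Walk.edges_cons] at hp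
        have h0 := (List.isChain_cons_cons.1 hp).1
        have := hc _ ((G.mem_edgeSet).2 h)
        have := hc _ ((G.mem_edgeSet).2 h')
        omega
  obtain ⟨a, b, d, h1, h2, h3⟩ := Fintype.two_lt_card_iff.1 (by omega : 2 < Fintype.card V)
  have e1 := hs a b (hadj a b h1)
  have e2 := hs a d (hadj a d h2)
  have e3 := hs b d (hadj b d h3)
  tauto
end

section
/- Let G be a connected graph, let B be the set of cut-edges of G, and let G* be the tree obtained from G by contracting each connected bridgeless (non-singleton) component of G − B to a single vertex, so that the edge set of G* is B. Then pc(G) ≤ max{3, Δ(G*)}, where Δ(G*) is the maximum degree of G*. -/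
/-- The tree `G*` obtained from `G` by deleting the set `B` of cut-edges and contracting
each connected component of `G − B` to a single vertex; two components are adjacent in `G*`
iff some edge of `G` (necessarily a bridge) joins them. Its edge set corresponds to `B`. -/
def bridgeTree {V : Type*} (G : SimpleGraph V) :
    SimpleGraph (G.deleteEdges {e | G.IsBridge e}).ConnectedComponent :=
  SimpleGraph.fromRel fun C D =>
    ∃ u v : V, (G.deleteEdges {e | G.IsBridge e}).connectedComponentMk u = C ∧
      (G.deleteEdges {e | G.IsBridge e}).connectedComponentMk v = D ∧ G.Adj u v


inductive PP {V : Type*} (G : SimpleGraph V) (c : V → V → ℕ) :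
    Set V → V → V → ℕ → ℕ → Prop
  | edge {A : Set V} {u v : V} (h : G.Adj u v) (hu : u ∈ A) (hv : v ∈ A) :
      PP G c A u v (c u v) (c u v)
  | cons {A B : Set V} {u w x : V} {s t : ℕ} (h : G.Adj u w) (hu : u ∉ A) (hc : c u w ≠ s)
      (hp : PP G c A w x s t) (hAB : A ⊆ B) (huB : u ∈ B) : PP G c B u x (c u w) t

namespace PP

variable {V : Type*} {G : SimpleGraph V} {c : V → V → ℕ} {A B D : Set V} {u v w x : V}
  {s t s' t' : ℕ}

lemma edge' (h : G.Adj u v) (hs : c u v = s) (hu : u ∈ A) (hv : v ∈ A) : PP G c A u v s s := by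
  subst hs; exact edge h hu hv

lemma cons' (h : G.Adj u w) (hs : c u w = s') (hu : u ∉ A) (hc : s' ≠ s)
    (hp : PP G c A w x s t) (hAB : A ⊆ B) (huB : u ∈ B) : PP G c B u x s' t := by
  subst hs; exact cons h hu hc hp hAB huB

lemma mono (h : PP G c A u v s t) (hAB : A ⊆ B) : PP G c B u v s t := by
  cases h with
  | edge h hu hv => exact edge h (hAB hu) (hAB hv)
  | cons h hu hc hp h1 h2 => exact cons h hu hc hp (h1.trans hAB) (hAB h2)

lemma src_mem (h : PP G c A u v s t) : u ∈ A := by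
  cases h <;> assumption

lemma dst_mem (h : PP G c A u v s t) : v ∈ A := by
  induction h with
  | edge h hu hv => exact hv
  | cons h hu hc hp h1 h2 ih => exact h1 ih

lemma append (h : PP G c A u v s t) (h' : PP G c B v w s' t') (hne : t ≠ s')
    (hd : ∀ z ∈ A, z ∈ B → z = v) (hA : A ⊆ D) (hB : B ⊆ D) : PP G c D u w s t' := by
  induction h generalizing D with
  | edge h hu hv =>
    refine cons h ?_ hne h' hB (hA hu)
    intro hb
    exact h.ne (hd _ hu hb)
  | @cons A1 B1 u1 w1 x1 s1 t1 h hu hc hp h1 h2 ih =>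
    refine cons (A := A1 ∪ B) h ?_ hc (ih h' hne (fun z hz => hd z (h1 hz))
      Set.subset_union_left Set.subset_union_right)
      (Set.union_subset (h1.trans hA) hB) (hA h2)
    rintro (hb | hb)
    · exact hu hb
    · have := hd _ h2 hb
      subst this
      exact hu hp.dst_mem

lemma rev (hc : ∀ a b, c a b = c b a) (h : PP G c A u v s t) : PP G c A v u t s := by
  induction h with
  | edge h hu hv => exact edge' h.symm (hc _ _) hv hu
  | @cons A1 B1 u1 w1 x1 s1 t1 h hu hcc hp h1 h2 ih =>
    refine append (A := A1) (B := {u1, w1}) ih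
      (edge' h.symm (hc _ _) (by simp) (by simp)) (Ne.symm hcc) ?_ h1 ?_
    · rintro z hz (rfl | hz')
      · exact absurd hz hu
      · exact hz'
    · rintro z (rfl | hz)
      · exact h2
      · rw [hz]; exact h1 hp.src_mem

lemma map {c' : V → V → ℕ} (φ : ℕ → ℕ) (hφ : Function.Injective φ)
    (h : PP G c A u v s t) (hcc : ∀ a ∈ A, ∀ b ∈ A, G.Adj a b → c' a b = φ (c a b)) :
    PP G c' A u v (φ s) (φ t) := by
  induction h with
  | edge h hu hv => exact edge' h (hcc _ hu _ hv h) hu hv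
  | @cons A1 B1 u1 w1 x1 s1 t1 h hu hc hp h1 h2 ih =>
    exact cons' h (hcc _ h2 _ (h1 hp.src_mem) h) hu (fun h => hc (hφ h))
      (ih fun a ha b hb => hcc a (h1 ha) b (h1 hb)) h1 h2

lemma lt {k : ℕ} (hk : ∀ a b, c a b < k) (h : PP G c A u v s t) : s < k ∧ t < k := by
  induction h with
  | edge h hu hv => exact ⟨hk _ _, hk _ _⟩
  | cons h hu hc hp h1 h2 ih => exact ⟨hk _ _, ih.2⟩

lemma toWalk {e : Sym2 V → ℕ} (he : ∀ a b, e s(a, b) = c a b) (h : PP G c A u v s t) :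
    ∃ p : G.Walk u v, p.IsPath ∧ (∀ z ∈ p.support, z ∈ A) ∧
      (p.edges.IsChain fun e' f => e e' ≠ e f) ∧ p.edges.head?.map e = some s := by
  induction h with
  | edge h hu hv =>
    refine ⟨SimpleGraph.Walk.cons h .nil, ?_, ?_, ?_, ?_⟩
    · simp [h.ne]
    · simp [hu, hv]
    · simp
    · simp [he]
  | @cons A1 B1 u1 w1 x1 s1 t1 h hu hc hp h1 h2 ih =>
    obtain ⟨p, hp1, hp2, hp3, hp4⟩ := ih
    refine ⟨SimpleGraph.Walk.cons h p, ?_, ?_, ?_, ?_⟩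
    · rw [SimpleGraph.Walk.cons_isPath_iff]
      exact ⟨hp1, fun hh => hu (hp2 _ hh)⟩
    · intro z hz
      rw [SimpleGraph.Walk.support_cons, List.mem_cons] at hz
      rcases hz with rfl | hz
      · exact h2
      · exact h1 (hp2 _ hz)
    · rw [SimpleGraph.Walk.edges_cons, List.isChain_cons]
      refine ⟨?_, hp3⟩
      intro y hy
      rw [he]
      rw [Option.mem_def] at hy
      rw [hy] at hp4
      simp at hp4
      rw [hp4]; exact hc
    · simp [he]

end PP

structure RT {V : Type*} (G : SimpleGraph V) where
  r : V
  p : V → V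
  d : V → ℕ
  pr : p r = r
  dr : d r = 0
  adj : ∀ v, v ≠ r → G.Adj v (p v)
  dp : ∀ v, v ≠ r → d v = d (p v) + 1

namespace RT

variable {V : Type*} {G : SimpleGraph V} (T : RT G)

def anc (u v : V) : Prop := ∃ n, T.p^[n] v = u

variable {T} {a b u v w x y z : V}

lemma anc_refl (u : V) : T.anc u u := ⟨0, rfl⟩

lemma anc_trans (h : T.anc u v) (h' : T.anc v w) : T.anc u w := by
  obtain ⟨n, rfl⟩ := h
  obtain ⟨k, rfl⟩ := h'
  exact ⟨n + k, by rw [Function.iterate_add_apply]⟩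

lemma anc_p (v : V) : T.anc (T.p v) v := ⟨1, rfl⟩

lemma anc_cases (h : T.anc u v) : u = v ∨ T.anc u (T.p v) := by
  obtain ⟨n, rfl⟩ := h
  cases n with
  | zero => left; rfl
  | succ n => right; exact ⟨n, rfl⟩

lemma anc_r (h : T.anc u T.r) : u = T.r := by
  obtain ⟨n, rfl⟩ := h
  exact Function.iterate_fixed T.pr n

lemma dp_le (v : V) : T.d (T.p v) ≤ T.d v := by
  by_cases h : v = T.r
  · rw [h, T.pr]
  · have := T.dp v h; omega

lemma anc_le (h : T.anc u v) : T.d u ≤ T.d v := by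
  obtain ⟨n, rfl⟩ := h
  induction n generalizing v with
  | zero => exact le_rfl
  | succ n ih => exact (ih (v := T.p v)).trans (T.dp_le v)

/-- strict ancestors are ancestors of the parent -/
lemma anc_strict (h : T.anc u v) (hne : u ≠ v) :
    v ≠ T.r ∧ T.anc u (T.p v) ∧ T.d u + 1 ≤ T.d v := by
  have hv : v ≠ T.r := by
    rintro rfl; exact hne (anc_r h)
  have h1 := (anc_cases h).resolve_left hne
  have h2 := anc_le h1
  have h3 := T.dp v hv
  exact ⟨hv, h1, by omega⟩

lemma anc_lt (h : T.anc u v) (hne : u ≠ v) : T.d u < T.d v := (anc_strict h hne).2.2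

lemma anc_eq (h : T.anc u v) (hd : T.d v ≤ T.d u) : u = v := by
  by_contra hne
  have := anc_lt h hne; omega

lemma anc_antisymm (h : T.anc u v) (h' : T.anc v u) : u = v := anc_eq h (anc_le h')

lemma p_ne (h : v ≠ T.r) : T.p v ≠ v := (T.adj v h).ne'

lemma anc_root (v : V) : T.anc T.r v := by
  induction hn : T.d v generalizing v with
  | zero =>
    by_cases h : v = T.r
    · rw [h]; exact anc_refl _
    · have := T.dp v h; omega
  | succ n ih =>
    by_cases h : v = T.r
    · rw [h]; exact anc_refl _
    · have := T.dp v h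
      exact anc_trans (ih (T.p v) (by omega)) (anc_p v)

lemma anc_comp (h : T.anc a v) (h' : T.anc b v) : T.anc a b ∨ T.anc b a := by
  obtain ⟨n, rfl⟩ := h
  obtain ⟨k, rfl⟩ := h'
  rcases le_total n k with hk | hk
  · right
    refine ⟨k - n, ?_⟩
    rw [← Function.iterate_add_apply]; congr 2; omega
  · left
    refine ⟨n - k, ?_⟩
    rw [← Function.iterate_add_apply]; congr 2; omega

lemma child (h : T.anc w u) (hne : w ≠ u) : ∃ e, e ≠ T.r ∧ T.p e = w ∧ T.anc e u := by
  obtain ⟨n, hn⟩ := h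
  induction n generalizing u with
  | zero => exact absurd hn.symm hne
  | succ n ih =>
    by_cases h1 : w = T.p u
    · refine ⟨u, ?_, h1.symm, anc_refl u⟩
      rintro rfl
      rw [T.pr] at h1; exact hne h1
    · obtain ⟨e, he1, he2, he3⟩ := ih h1 hn
      exact ⟨e, he1, he2, anc_trans he3 (anc_p u)⟩

lemma fork (h1 : ¬ T.anc u x) (h2 : ¬ T.anc x u) : ∃ a b, a ≠ T.r ∧ b ≠ T.r ∧
    T.p a = T.p b ∧ T.anc a u ∧ T.anc b x ∧ ¬ T.anc a x ∧ ¬ T.anc b u := by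
  induction hn : T.d u generalizing u with
  | zero =>
    exfalso
    have : u = T.r := (anc_eq (anc_root u) (by omega)).symm
    exact h1 (this ▸ anc_root x)
  | succ n ih =>
    have hu : u ≠ T.r := by rintro rfl; exact h1 (anc_root x)
    have hd := T.dp u hu
    by_cases h3 : T.anc (T.p u) x
    · have h4 : T.p u ≠ x := by
        intro h4; exact h2 (h4 ▸ anc_p u)
      obtain ⟨e, he1, he2, he3⟩ := child h3 h4
      refine ⟨u, e, hu, he1, he2.symm, anc_refl u, he3, h1, ?_⟩
      intro h5
      have h6 := T.dp e he1
      rw [he2] at h6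
      have := anc_eq h5 (by omega)
      exact h1 (this ▸ he3)
    · obtain ⟨a, b, ha, hb, hab, h4, h5, h6, h7⟩ :=
        ih h3 (fun h => h2 (anc_trans h (anc_p u))) (by omega)
      refine ⟨a, b, ha, hb, hab, anc_trans h4 (anc_p u), h5, h6, fun h8 => ?_⟩
      rcases anc_comp h8 (anc_p u) with h9 | h9
      · exact h7 h9
      · exact h3 (anc_trans h9 h5)

end RT

namespace RT

variable {V : Type*} {G : SimpleGraph V} (T : RT G)

def c0 (u v : V) : ℕ :=
  if T.d u = T.d v + 1 then T.d u % 2 else if T.d v = T.d u + 1 then T.d v % 2 else 2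

def Esc (a z y : V) : Prop :=
  T.anc a z ∧ G.Adj z y ∧ T.anc y a ∧ y ≠ a ∧ T.d y + 2 ≤ T.d z

def Top (a : V) : Prop := ∀ z y, ¬ T.Esc a z y

def D (ρ : V) : Set V := {v | T.anc ρ v ∧ ∀ a, T.anc ρ a → a ≠ ρ → T.anc a v → ¬ T.Top a}

open Classical in
noncomputable def m (u : V) : ℕ :=
  if ∃ a, ¬ T.Top a ∧ T.anc a u ∧ ∀ z y, T.Esc a z y → z = u then (T.d u + 1) % 2 else 2

variable {T} {a b u v w x y z ρ : V}

lemma c0_symm (a b : V) : T.c0 a b = T.c0 b a := by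
  unfold c0; split_ifs <;> omega

lemma c0_lt (a b : V) : T.c0 a b < 3 := by
  unfold c0; split_ifs <;> omega

lemma c0_back (h : T.d y + 2 ≤ T.d z) : T.c0 z y = 2 := by
  unfold c0; split_ifs <;> omega

lemma c0_p (h : v ≠ T.r) : T.c0 v (T.p v) = T.d v % 2 := by
  unfold c0; rw [if_pos (T.dp v h)]

lemma not_top : ¬ T.Top a ↔ ∃ z y, T.Esc a z y := by
  unfold Top; push Not; rfl

lemma D_self (ρ : V) : ρ ∈ T.D ρ :=
  ⟨anc_refl ρ, fun _ h hne h' => absurd (anc_antisymm h' h) hne⟩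

lemma D_down (hv : v ∈ T.D ρ) (h : T.anc ρ w) (h' : T.anc w v) : w ∈ T.D ρ :=
  ⟨h, fun a h1 h2 h3 => hv.2 a h1 h2 (anc_trans h3 h')⟩

lemma D_top (hv : v ∈ T.D ρ) (h : T.Top v) : v = ρ := by
  by_contra hne
  exact hv.2 v hv.1 hne (anc_refl v) h

lemma Esc_mono (h : T.Esc a z y) (h1 : T.anc a b) (h2 : T.anc b z) : T.Esc b z y := by
  obtain ⟨e1, e2, e3, e4, e5⟩ := h
  refine ⟨h2, e2, anc_trans e3 h1, ?_, e5⟩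
  rintro rfl
  exact e4 (anc_antisymm e3 h1)

lemma D_esc (hρ : T.Top ρ) (ha : a ∈ T.D ρ) (h : T.Esc a z y) : z ∈ T.D ρ ∧ y ∈ T.D ρ := by
  constructor
  · refine ⟨anc_trans ha.1 h.1, fun b h1 h2 h3 => ?_⟩
    rcases anc_comp h3 h.1 with h4 | h4
    · exact ha.2 b h1 h2 h4
    · exact fun ht => ht z y (Esc_mono h h4 h3)
  · rcases anc_comp ha.1 h.2.2.1 with h4 | h4
    · exact D_down ha h4 h.2.2.1
    · by_cases h5 : y = ρ
      · rw [h5]; exact D_self ρ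
      · exact absurd ⟨anc_trans ha.1 h.1, h.2.1, h4, h5, h.2.2.2.2⟩ (hρ z y)

/-- vertical tree path -/
lemma up (h : T.anc w u) (hne : w ≠ u) :
    PP G T.c0 {v | T.anc w v ∧ T.anc v u} u w (T.d u % 2) ((T.d w + 1) % 2) := by
  induction hn : T.d u generalizing u with
  | zero => have := anc_lt h hne; omega
  | succ n ih =>
    obtain ⟨hu, h1, _⟩ := anc_strict h hne
    have hd := T.dp u hu
    rw [← hn]
    by_cases h2 : w = T.p u
    · have e : (T.d w + 1) % 2 = T.d u % 2 := by rw [h2, hd]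
      rw [e]
      refine PP.edge' (h2 ▸ T.adj u hu) ?_ ⟨h, anc_refl u⟩ ⟨anc_refl w, h⟩
      rw [h2]; exact c0_p hu
    · have := ih h1 h2 (by omega)
      refine PP.cons' (T.adj u hu) (c0_p hu) ?_ ?_ this ?_ ⟨h, anc_refl u⟩
      · intro hh
        exact p_ne hu (anc_antisymm (anc_p u) hh.2)
      · omega
      · exact fun v hv => ⟨hv.1, anc_trans hv.2 (anc_p u)⟩

lemma down (h : T.anc w u) (hne : w ≠ u) :
    PP G T.c0 {v | T.anc w v ∧ T.anc v u} w u ((T.d w + 1) % 2) (T.d u % 2) :=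
  (up h hne).rev c0_symm

lemma m_eq (u : V) : T.m u = (T.d u + 1) % 2 ∨ T.m u = 2 := by
  unfold m; split_ifs <;> simp

lemma m_lt (u : V) : T.m u < 3 := by
  rcases T.m_eq u with h | h <;> omega

lemma par_ne_m (u : V) : T.d u % 2 ≠ T.m u := by
  rcases T.m_eq u with h | h <;> omega

lemma m_two (h : T.m u = 2) (ha : ¬ T.Top a) (hau : T.anc a u) :
    ∃ z y, T.Esc a z y ∧ z ≠ u := by
  unfold m at h
  split_ifs at h with h1
  · omega
  · push Not at h1
    obtain ⟨z, y, h2, h3⟩ := h1 a ha hau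
    exact ⟨z, y, h2, h3⟩

lemma m_t (h : T.m u ≠ 2) : ∃ a y, T.Esc a u y ∧ ∀ z y, T.Esc a z y → z = u := by
  unfold m at h
  split_ifs at h with h1
  · obtain ⟨a, h2, h3, h4⟩ := h1
    obtain ⟨z, y, h5⟩ := not_top.1 h2
    have := h4 _ _ h5
    subst this
    exact ⟨a, y, h5, h4⟩
  · exact absurd rfl h

/-- the zigzag lemma -/
lemma zig (hρ : T.Top ρ) (hu : u ∈ T.D ρ) (ha : T.anc a u) (hρa : T.anc ρ a) (hne : a ≠ ρ) :
    ∃ y s, T.anc y a ∧ y ≠ a ∧ y ∈ T.D ρ ∧ s ≠ T.m u ∧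
      PP G T.c0 ({v | T.anc a v} ∩ T.D ρ ∪ {y}) u y s 2 := by
  induction hn : T.d u - T.d a using Nat.strong_induction_on generalizing a with
  | _ n ih =>
  have haD : a ∈ T.D ρ := D_down hu hρa ha
  have hnt : ¬ T.Top a := hu.2 a hρa hne ha
  by_cases hdir : T.m u ≠ 2 ∧ ∃ y, T.Esc a u y
  · obtain ⟨hm, y, hy⟩ := hdir
    refine ⟨y, 2, hy.2.2.1, hy.2.2.2.1, (D_esc hρ haD hy).2, Ne.symm hm, ?_⟩
    exact PP.edge' hy.2.1 (c0_back hy.2.2.2.2) (Or.inl ⟨ha, hu⟩) (Or.inr rfl)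
  · obtain ⟨z, y, hz, hzu⟩ : ∃ z y, T.Esc a z y ∧ z ≠ u := by
      by_cases hm : T.m u = 2
      · exact m_two hm hnt ha
      · obtain ⟨z, y, hz⟩ := not_top.1 hnt
        refine ⟨z, y, hz, ?_⟩
        rintro rfl
        exact hdir ⟨hm, y, hz⟩
    obtain ⟨hzD, hyD⟩ := D_esc hρ haD hz
    have hya : ∀ v, T.anc a v → v ≠ y := by
      rintro v hv rfl
      exact hz.2.2.2.1 (anc_antisymm hz.2.2.1 hv)
    have hback : PP G T.c0 {z, y} z y 2 2 :=
      PP.edge' hz.2.1 (c0_back hz.2.2.2.2) (by simp) (by simp)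
    have hbsub : ({z, y} : Set V) ⊆ {v | T.anc a v} ∩ T.D ρ ∪ {y} := by
      rintro v (rfl | rfl)
      · exact Or.inl ⟨hz.1, hzD⟩
      · exact Or.inr rfl
    by_cases h1 : T.anc z u
    · refine ⟨y, _, hz.2.2.1, hz.2.2.2.1, hyD, par_ne_m u,
        (up h1 hzu).append hback (by omega) ?_ ?_ hbsub⟩
      · rintro v hv (rfl | rfl)
        · rfl
        · exact absurd rfl (hya v (anc_trans hz.1 hv.1))
      · intro v hv
        exact Or.inl ⟨anc_trans hz.1 hv.1, D_down hu (anc_trans hρa (anc_trans hz.1 hv.1)) hv.2⟩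
    · by_cases h2 : T.anc u z
      · have hm : T.m u = 2 := by
          by_contra hm
          obtain ⟨a', y', h3, h4⟩ := m_t hm
          rcases anc_comp ha h3.1 with h5 | h5
          · exact hzu (h4 z y (Esc_mono hz h5 (anc_trans h3.1 h2)))
          · exact hdir ⟨hm, y', Esc_mono h3 h5 ha⟩
        refine ⟨y, _, hz.2.2.1, hz.2.2.2.1, hyD, ?_,
          (down h2 (Ne.symm hzu)).append hback (by omega) ?_ ?_ hbsub⟩
        · omega
        · rintro v hv (rfl | rfl)
          · rfl
          · exact absurd rfl (hya v (anc_trans ha hv.1))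
        · intro v hv
          exact Or.inl ⟨anc_trans ha hv.1, D_down hzD (anc_trans hu.1 hv.1) hv.2⟩
      · -- incomparable
        obtain ⟨e, f, he, hf, hef, heu, hfz, hez, hfu⟩ := fork h2 h1
        have hae : T.anc a e := by
          rcases anc_comp ha heu with h | h
          · exact h
          · exact absurd (anc_trans h hz.1) hez
        have hae' : a ≠ e := by rintro rfl; exact hez hz.1
        have haf := (anc_strict hae hae').2.1
        have hlt := anc_lt hae hae'
        have hle := anc_le heu
        have hρe : T.anc ρ e := anc_trans hρa hae
        obtain ⟨y1, s, hy1, hy1', hy1D, hs, hP⟩ := ih _ (by omega) heu hρe (by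
          rintro rfl; exact hne (anc_antisymm hae hρa)) rfl
        have hy1p := (anc_strict hy1 hy1').2.1
        by_cases h3 : T.anc a y1
        · have hy1z : T.anc y1 z := anc_trans (hef ▸ hy1p) (anc_trans (anc_p f) hfz)
          have hy1z' : y1 ≠ z := by
            rintro rfl
            exact h1 (anc_trans hy1 heu)
          have hd2 := (down hy1z hy1z').append hback (D := ({v | T.anc y1 v ∧ T.anc v z} ∪ {y}))
            (by omega) (by
              rintro v hv (rfl | rfl)
              · rfl
              · exact absurd rfl (hya v (anc_trans h3 hv.1)))
            Set.subset_union_left (by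
              rintro v (rfl | rfl)
              · exact Or.inl ⟨hy1z, anc_refl _⟩
              · exact Or.inr rfl)
          refine ⟨y, s, hz.2.2.1, hz.2.2.2.1, hyD, hs, hP.append hd2 (by omega) ?_ ?_ ?_⟩
          · rintro v (hv | hv) hv'
            · rcases hv' with hv' | hv'
              · exact absurd (anc_trans hv.1 hv'.2) hez
              · exact absurd hv' (hya v (anc_trans hae hv.1))
            · exact hv
          · rintro v (hv | hv)
            · exact Or.inl ⟨anc_trans hae hv.1, hv.2⟩
            · rw [Set.mem_singleton_iff.1 hv]
              exact Or.inl ⟨h3, hy1D⟩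
          · rintro v (hv | hv)
            · exact Or.inl ⟨anc_trans h3 hv.1, D_down hzD (anc_trans hρa (anc_trans h3 hv.1)) hv.2⟩
            · exact Or.inr hv
        · have h4 : T.anc y1 a := (anc_comp hy1 hae).resolve_right h3
          refine ⟨y1, s, h4, ?_, hy1D, hs, hP.mono ?_⟩
          · rintro rfl; exact h3 (anc_refl _)
          · rintro v (hv | hv)
            · exact Or.inl ⟨anc_trans hae hv.1, hv.2⟩
            · exact Or.inr hv

/-- zigzag out of a child of `w`, then down to a place `x` at or below `w` outside the child,
or exactly `w`. -/
lemma zig_down (hρ : T.Top ρ) (hu : u ∈ T.D ρ) (ha : T.anc a u) (hρa : T.anc ρ a) (hne : a ≠ ρ)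
    (hx : x ∈ T.D ρ) (hwx : T.anc (T.p a) x) (hax : ¬ T.anc a x) :
    ∃ s t, s ≠ T.m u ∧ (t = T.d x % 2 ∨ (t = 2 ∧ x = T.p a)) ∧
      PP G T.c0 (({v | T.anc a v} ∪ {v | T.anc v x}) ∩ T.D ρ) u x s t := by
  obtain ⟨y, s, h1, h2, h3, h4, h5⟩ := zig hρ hu ha hρa hne
  have hyp := (anc_strict h1 h2).2.1
  have hyx := anc_trans hyp hwx
  by_cases hxy : y = x
  · subst hxy
    refine ⟨s, 2, h4, Or.inr ⟨rfl, anc_antisymm hyp hwx⟩, h5.mono ?_⟩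
    rintro v (hv | hv)
    · exact ⟨Or.inl hv.1, hv.2⟩
    · rw [Set.mem_singleton_iff.1 hv]; exact ⟨Or.inr (anc_refl _), h3⟩
  · refine ⟨s, _, h4, Or.inl rfl, h5.append (down hyx hxy) (by omega) ?_ ?_ ?_⟩
    · rintro v (hv | hv) hv'
      · exact absurd (anc_trans hv.1 hv'.2) hax
      · exact hv
    · rintro v (hv | hv)
      · exact ⟨Or.inl hv.1, hv.2⟩
      · rw [Set.mem_singleton_iff.1 hv]; exact ⟨Or.inr hyx, h3⟩
    · intro v hv
      exact ⟨Or.inr hv.2, D_down hx (anc_trans h3.1 hv.1) hv.2⟩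

lemma jump (h : T.Esc x z y) : ∃ t, t ≠ T.d x % 2 ∧
    PP G T.c0 ({v | T.anc x v ∧ T.anc v z} ∪ {y}) y x 2 t := by
  have hb : ∀ A : Set V, y ∈ A → z ∈ A → PP G T.c0 A y z 2 2 := fun A h1 h2 =>
    PP.edge' h.2.1.symm (by rw [c0_symm]; exact c0_back h.2.2.2.2) h1 h2
  by_cases hx : x = z
  · subst hx
    exact ⟨2, by omega, hb _ (Or.inr rfl) (Or.inl ⟨anc_refl _, anc_refl _⟩)⟩
  · refine ⟨_, ?_, (hb {y, z} (by simp) (by simp)).append (up h.1 hx) (by omega) ?_ ?_ ?_⟩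
    · omega
    · rintro v (rfl | hv) hv'
      · exact absurd (anc_antisymm h.2.2.1 hv'.1) h.2.2.2.1
      · exact hv
    · rintro v (rfl | hv)
      · exact Or.inr rfl
      · rw [Set.mem_singleton_iff.1 hv]; exact Or.inl ⟨h.1, anc_refl _⟩
    · exact Set.subset_union_left

/-- fork inside a component -/
lemma forkD (hu : u ∈ T.D ρ) (hx : x ∈ T.D ρ) (h1 : ¬ T.anc u x) (h2 : ¬ T.anc x u) :
    ∃ a b, T.p a = T.p b ∧ T.anc a u ∧ T.anc b x ∧ ¬ T.anc a x ∧ ¬ T.anc b u ∧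
      T.anc ρ a ∧ a ≠ ρ ∧ T.anc ρ b ∧ b ≠ ρ := by
  obtain ⟨a, b, ha, hb, hab, h3, h4, h5, h6⟩ := fork h1 h2
  refine ⟨a, b, hab, h3, h4, h5, h6, ?_, ?_, ?_, ?_⟩
  · rcases anc_comp hu.1 h3 with h | h
    · exact h
    · exact absurd (anc_trans h hx.1) h5
  · rintro rfl; exact h5 hx.1
  · rcases anc_comp hx.1 h4 with h | h
    · exact h
    · exact absurd (anc_trans h hu.1) h6
  · rintro rfl; exact h6 hu.1

lemma main_M_anc (hρ : T.Top ρ) (hu : u ∈ T.D ρ) (hx : x ∈ T.D ρ) (hne : u ≠ x)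
    (h : T.anc x u) :
    ∃ s t, s ≠ T.m u ∧ t ≠ T.m x ∧ PP G T.c0 (T.D ρ) u x s t := by
  by_cases hm : T.m x = 2
  · refine ⟨_, _, par_ne_m u, ?_, (up h hne.symm).mono
      fun v hv => D_down hu (anc_trans hx.1 hv.1) hv.2⟩
    omega
  · obtain ⟨e, he, hp, heu⟩ := child h hne.symm
    subst hp
    obtain ⟨s, t, h1, h2, h3⟩ := zig_down hρ hu heu (anc_trans hx.1 (anc_p e))
      (by rintro rfl; exact p_ne he (anc_antisymm (anc_p e) hx.1)) hx (anc_refl _)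
      (fun h => p_ne he (anc_antisymm (anc_p e) h))
    refine ⟨s, t, h1, ?_, h3.mono Set.inter_subset_right⟩
    rcases h2 with h2 | h2
    · rw [h2]; exact par_ne_m _
    · rw [h2.1]; exact Ne.symm hm

lemma main_M (hρ : T.Top ρ) (hu : u ∈ T.D ρ) (hx : x ∈ T.D ρ) (hne : u ≠ x) :
    ∃ s t, s ≠ T.m u ∧ t ≠ T.m x ∧ PP G T.c0 (T.D ρ) u x s t := by
  by_cases h1 : T.anc x u
  · exact main_M_anc hρ hu hx hne h1
  by_cases h2 : T.anc u x
  · obtain ⟨s, t, h3, h4, h5⟩ := main_M_anc hρ hx hu hne.symm h2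
    exact ⟨t, s, h4, h3, h5.rev c0_symm⟩
  obtain ⟨a, b, hab, h3, h4, h5, h6, h7, h8, h9, h10⟩ := forkD hu hx h2 h1
  obtain ⟨s, t, k1, k2, k3⟩ := zig_down hρ hu h3 h7 h8 hx
    (hab ▸ anc_trans (anc_p b) h4) h5
  refine ⟨s, t, k1, ?_, k3.mono Set.inter_subset_right⟩
  rcases k2 with k2 | k2
  · rw [k2]; exact par_ne_m _
  · exact absurd (k2.2 ▸ anc_trans (anc_p a) h3) h1

lemma main_S2 (hρ : T.Top ρ) (hu : u ∈ T.D ρ) (hx : x ∈ T.D ρ) (hne : u ≠ x) :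
    ∃ s t s' t', t ≠ t' ∧ PP G T.c0 (T.D ρ) u x s t ∧ PP G T.c0 (T.D ρ) u x s' t' := by
  by_cases h1 : T.anc x u
  · obtain ⟨e, he, hp, heu⟩ := child h1 hne.symm
    subst hp
    obtain ⟨s, t, k1, k2, k3⟩ := zig_down hρ hu heu (anc_trans hx.1 (anc_p e))
      (by rintro rfl; exact p_ne he (anc_antisymm (anc_p e) hx.1)) hx (anc_refl _)
      (fun h => p_ne he (anc_antisymm (anc_p e) h))
    refine ⟨s, t, _, _, ?_, k3.mono Set.inter_subset_right, (up h1 hne.symm).mono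
      fun v hv => D_down hu (anc_trans hx.1 hv.1) hv.2⟩
    omega
  have hxρ : x ≠ ρ := by rintro rfl; exact h1 hu.1
  obtain ⟨z, y, hz⟩ := not_top.1 (hx.2 x hx.1 hxρ (anc_refl x))
  obtain ⟨hzD, hyD⟩ := D_esc hρ hx hz
  obtain ⟨t', ht', hJ⟩ := jump hz
  have hJs : ({v | T.anc x v ∧ T.anc v z} ∪ {y}) ⊆ T.D ρ := by
    rintro v (hv | hv)
    · exact D_down hzD (anc_trans hx.1 hv.1) hv.2
    · rw [Set.mem_singleton_iff.1 hv]; exact hyD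
  by_cases h2 : T.anc u x
  · have hdn := (down h2 hne).mono
      (fun v hv => D_down hx (anc_trans hu.1 hv.1) hv.2 : _ ⊆ T.D ρ)
    by_cases hy : y = u
    · subst hy
      exact ⟨_, _, _, _, Ne.symm ht', hdn, hJ.mono hJs⟩
    · rcases anc_comp h2 hz.2.2.1 with h3 | h3
      · refine ⟨_, _, _, _, Ne.symm ht', hdn,
          (down h3 (Ne.symm hy)).append hJ (by omega) ?_ ?_ hJs⟩
        · rintro v hv (hv' | hv')
          · exact absurd (anc_antisymm hz.2.2.1 (anc_trans hv'.1 hv.2)) hz.2.2.2.1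
          · exact hv'
        · exact fun v hv => D_down hyD (anc_trans hu.1 hv.1) hv.2
      · refine ⟨_, _, _, _, Ne.symm ht', hdn,
          (up h3 hy).append hJ (by omega) ?_ ?_ hJs⟩
        · rintro v hv (hv' | hv')
          · exact absurd (anc_trans hv'.1 hv.2) h1
          · exact hv'
        · exact fun v hv => D_down hu (anc_trans hyD.1 hv.1) hv.2
  · obtain ⟨a, b, hab, h3, h4, h5, h6, h7, h8, h9, h10⟩ := forkD hu hx h2 h1
    have hwx := hab ▸ anc_trans (anc_p b) h4
    obtain ⟨s, t, k1, k2, k3⟩ := zig_down hρ hu h3 h7 h8 hx hwx h5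
    have ht : t = T.d x % 2 := by
      rcases k2 with k2 | k2
      · exact k2
      · exact absurd (k2.2 ▸ anc_trans (anc_p a) h3) h1
    subst ht
    by_cases h11 : T.anc b y
    · have hay : ¬ T.anc a y := fun h => h5 (anc_trans h hz.2.2.1)
      obtain ⟨s1, t1, l1, l2, l3⟩ := zig_down hρ hu h3 h7 h8 hyD
        (hab ▸ anc_trans (anc_p b) h11) hay
      have ht1 : t1 ≠ 2 := by
        rcases l2 with l2 | l2
        · omega
        · exact absurd (anc_trans (anc_trans (l2.2 ▸ h11) (anc_p a)) h3) h6
      refine ⟨_, _, _, _, Ne.symm ht', k3.mono Set.inter_subset_right,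
        l3.append hJ ht1 ?_ Set.inter_subset_right hJs⟩
      rintro v hv (hv' | hv')
      · rcases hv.1 with hv1 | hv1
        · rcases anc_comp (anc_trans hv1 hv'.2) hz.1 with h | h
          · exact absurd h h5
          · exact absurd (anc_trans h h3 |> fun _ => (anc_trans h h3)) h1
        · exact absurd (anc_antisymm hz.2.2.1 (anc_trans hv'.1 hv1)) hz.2.2.2.1
      · exact hv'
    · have hyb : T.anc y b := (anc_comp hz.2.2.1 h4).resolve_right h11
      have hyb' : y ≠ b := by rintro rfl; exact h11 (anc_refl _)
      have hyw := (anc_strict hyb hyb').2.1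
      rw [← hab] at hyw
      have hyu := anc_trans hyw (anc_trans (anc_p a) h3)
      have hyu' : y ≠ u := by rintro rfl; exact h2 hz.2.2.1
      refine ⟨_, _, _, _, Ne.symm ht', k3.mono Set.inter_subset_right,
        (up hyu hyu').append hJ (by omega) ?_ ?_ hJs⟩
      · rintro v hv (hv' | hv')
        · exact absurd (anc_trans hv'.1 hv.2) h1
        · exact hv'
      · exact fun v hv => D_down hu (anc_trans hyD.1 hv.1) hv.2

lemma main_S (hρ : T.Top ρ) (hu : u ∈ T.D ρ) (hx : x ∈ T.D ρ) (hne : u ≠ x) (q : ℕ) :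
    ∃ s t, t ≠ q ∧ PP G T.c0 (T.D ρ) u x s t := by
  obtain ⟨s, t, s', t', h1, h2, h3⟩ := main_S2 hρ hu hx hne
  by_cases h : t = q
  · exact ⟨s', t', by omega, h3⟩
  · exact ⟨s, t, h, h2⟩

end RT

lemma inj_tool {V : Type*} (S : Finset V) (R : Finset ℕ) (h : S.card ≤ R.card) :
    ∃ f : V → ℕ, (∀ i ∈ S, f i ∈ R) ∧ ∀ i ∈ S, ∀ j ∈ S, f i = f j → i = j := by
  obtain ⟨f, h1, h2⟩ := Set.Finite.exists_injOn_of_encard_le (s := (S : Set V)) (t := (R : Set ℕ))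
    S.finite_toSet (by rw [Set.encard_coe_eq_coe_finsetCard, Set.encard_coe_eq_coe_finsetCard]
                       exact_mod_cast h)
  exact ⟨f, fun i hi => by simpa using h1 (by simpa using hi), fun i hi j hj hij => h2 (by simpa using hi) (by simpa using hj) hij⟩

namespace RT

variable {V : Type*} {G : SimpleGraph V} {T : RT G} {ρ : V}

open Classical in
lemma pattern (hρ : T.Top ρ) (k : ℕ) (hk : 3 ≤ k) (I : Finset V) (hI : I.card ≤ k) (att : V → V)
    (hatt : ∀ i ∈ I, att i ∈ T.D ρ) :
    ∃ f : V → ℕ, (∀ i ∈ I, f i < k) ∧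
      (∀ i ∈ I, ∀ j ∈ I, i ≠ j → att i = att j → f i ≠ f j) ∧
      (∀ i ∈ I, ∀ j ∈ I, att i ≠ att j → ∃ s t, s ≠ f i ∧ t ≠ f j ∧
        PP G T.c0 (T.D ρ) (att i) (att j) s t) := by
  by_cases hc : ∀ x, (I.filter fun i => att i = x).card ≤ k - 2
  · have h1 : ∀ x, ∃ f : V → ℕ, (∀ i ∈ I, att i = x → f i ∈ insert (T.m x) (Finset.Ico 3 k)) ∧
        ∀ i ∈ I, ∀ j ∈ I, att i = x → att j = x → f i = f j → i = j := by
      intro x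
      obtain ⟨f, h1, h2⟩ := inj_tool (I.filter fun i => att i = x)
        (insert (T.m x) (Finset.Ico 3 k)) (by
          rw [Finset.card_insert_of_notMem, Nat.card_Ico]
          · have := hc x; omega
          · have := T.m_lt x
            simp; omega)
      refine ⟨f, fun i hi hx => h1 i (by simp [hi, hx]), fun i hi j hj hx hx' =>
        h2 i (by simp [hi, hx]) j (by simp [hj, hx'])⟩
    choose F hF1 hF2 using h1
    have hF3 : ∀ i ∈ I, F (att i) i = T.m (att i) ∨ (3 ≤ F (att i) i ∧ F (att i) i < k) := by
      intro i hi
      have := hF1 _ i hi rfl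
      simpa using this
    refine ⟨fun i => F (att i) i, ?_, ?_, ?_⟩
    · intro i hi
      have := T.m_lt (att i)
      rcases hF3 i hi with h | h <;> simp only <;> omega
    · intro i hi j hj hij he h
      simp only [← he] at h
      exact hij (hF2 _ i hi j hj rfl he.symm h)
    · intro i hi j hj hij
      have hai := hatt i hi
      have haj := hatt j hj
      rcases hF3 i hi with h | h
      · rcases hF3 j hj with h' | h'
        · simp only [h, h']
          exact main_M hρ hai haj hij
        · obtain ⟨s, t, h3, h4⟩ := main_S hρ haj hai hij.symm (F (att i) i)
          have := (h4.lt c0_lt).1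
          exact ⟨t, s, h3, by simp only; omega, h4.rev c0_symm⟩
      · obtain ⟨s, t, h3, h4⟩ := main_S hρ hai haj hij (F (att j) j)
        have := (h4.lt c0_lt).1
        exact ⟨s, t, by simp only; omega, h3, h4⟩
  · push Not at hc
    obtain ⟨x, hx⟩ := hc
    by_cases hall : ∀ i ∈ I, att i = x
    · obtain ⟨f, h1, h2⟩ := inj_tool I (Finset.range k) (by simpa using hI)
      refine ⟨f, fun i hi => by simpa using h1 i hi, fun i hi j hj hij _ h => hij (h2 i hi j hj h),
        fun i hi j hj h => absurd ((hall i hi).trans (hall j hj).symm) h⟩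
    · push Not at hall
      obtain ⟨e, he, hex⟩ := hall
      have hcard := Finset.card_filter_add_card_filter_not (s := I) (fun i => att i = x)
      have heq : (I.filter fun i => ¬ att i = x).card ≤ 1 := by omega
      have huniq : ∀ i ∈ I, att i ≠ x → i = e := fun i hi hne =>
        Finset.card_le_one.1 heq i (by simp [hi, hne]) e (by simp [he, hex])
      have hpos : 0 < (I.filter fun i => ¬ att i = x).card :=
        Finset.card_pos.2 ⟨e, by simp [he, hex]⟩
      obtain ⟨i0, hi0⟩ : (I.filter fun i => att i = x).Nonempty :=
        Finset.card_pos.1 (by omega)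
      have hi0' := Finset.mem_filter.1 hi0
      have hxD : x ∈ T.D ρ := hi0'.2 ▸ hatt i0 hi0'.1
      obtain ⟨s, t, s', t', g1, g2, g3⟩ := main_S2 hρ (hatt e he) hxD hex
      obtain ⟨b, hb, hbs, hbs'⟩ : ∃ b, b < 3 ∧ b ≠ s ∧ b ≠ s' := by
        by_cases h0 : 0 ≠ s ∧ 0 ≠ s'
        · exact ⟨0, by omega, h0⟩
        by_cases h1 : 1 ≠ s ∧ 1 ≠ s'
        · exact ⟨1, by omega, h1⟩
        · exact ⟨2, by omega, by omega, by omega⟩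
      obtain ⟨f, h1, h2⟩ := inj_tool (I.filter fun i => att i = x) ((Finset.range k).erase b) (by
        rw [Finset.card_erase_of_mem (by simp; omega), Finset.card_range]; omega)
      have key : ∀ j ∈ I, att j = x → ∃ s1 t1, s1 ≠ b ∧ t1 ≠ f j ∧
          PP G T.c0 (T.D ρ) (att e) x s1 t1 := by
        intro j hj hjx
        by_cases h : t = f j
        · exact ⟨s', t', hbs'.symm, by omega, g3⟩
        · exact ⟨s, t, hbs.symm, h, g2⟩
      refine ⟨fun i => if att i = x then f i else b, ?_, ?_, ?_⟩
      · intro i hi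
        simp only
        split_ifs with h
        · have := h1 i (by simp [hi, h])
          simp at this; exact this.2
        · omega
      · intro i hi j hj hij hatt'
        simp only
        split_ifs with h h' h'
        · exact fun hh => hij (h2 i (by simp [hi, h]) j (by simp [hj, h']) hh)
        · exact absurd (hatt' ▸ h) h'
        · exact absurd (hatt' ▸ h') h
        · exact absurd ((huniq i hi h).trans (huniq j hj h').symm) hij
      · intro i hi j hj hij
        simp only
        split_ifs with h h' h'
        · exact absurd (h.trans h'.symm) hij
        · rw [huniq j hj h', h]
          obtain ⟨s1, t1, k1, k2, k3⟩ := key i hi h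
          exact ⟨t1, s1, k2, k1, k3.rev c0_symm⟩
        · rw [huniq i hi h, h']
          exact key j hj h'
        · exact absurd (by rw [huniq i hi h, huniq j hj h']) hij

end RT

namespace RT

variable {V : Type*} {G : SimpleGraph V} {T : RT G} {ρ ρ1 ρ2 u v w x y z : V}

lemma top_r : T.Top T.r := by
  rintro z y ⟨_, _, h, h', _⟩
  exact h' (anc_r h)

lemma tau_ex (v : V) : ∃ ρ, T.Top ρ ∧ v ∈ T.D ρ := by
  induction hn : T.d v generalizing v with
  | zero =>
    have : v = T.r := (anc_eq (anc_root v) (by omega)).symm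
    exact ⟨v, this ▸ top_r, D_self v⟩
  | succ n ih =>
    by_cases ht : T.Top v
    · exact ⟨v, ht, D_self v⟩
    · have hv : v ≠ T.r := by rintro rfl; exact ht top_r
      have := T.dp v hv
      obtain ⟨ρ, h1, h2⟩ := ih (T.p v) (by omega)
      refine ⟨ρ, h1, anc_trans h2.1 (anc_p v), fun a h3 h4 h5 => ?_⟩
      rcases anc_cases h5 with rfl | h5
      · exact ht
      · exact h2.2 a h3 h4 h5

lemma tau_uniq (h1 : T.Top ρ1) (h2 : T.Top ρ2) (hv1 : v ∈ T.D ρ1) (hv2 : v ∈ T.D ρ2) :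
    ρ1 = ρ2 := by
  by_contra hne
  rcases anc_comp hv1.1 hv2.1 with h | h
  · exact hv1.2 _ h (Ne.symm hne) hv2.1 h2
  · exact hv2.2 _ h hne hv1.1 h1

lemma not_anc_p (h : v ≠ T.r) : ¬ T.anc v (T.p v) := fun h' =>
  p_ne h (anc_antisymm (anc_p v) h')

lemma exitD (hv : T.anc ρ v) (hn : v ∉ T.D ρ) :
    ∃ ρ1, T.Top ρ1 ∧ T.anc ρ1 v ∧ T.anc ρ ρ1 ∧ ρ1 ≠ ρ ∧ T.p ρ1 ∈ T.D ρ := by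
  induction hk : T.d v generalizing v with
  | zero =>
    exact absurd (anc_eq hv (by omega) ▸ D_self ρ) hn
  | succ n ih =>
    have hne : ρ ≠ v := by rintro rfl; exact hn (D_self _)
    obtain ⟨h1, h2, h3⟩ := anc_strict hv hne
    have := T.dp v h1
    by_cases hp : T.p v ∈ T.D ρ
    · refine ⟨v, ?_, anc_refl v, hv, hne.symm, hp⟩
      by_contra ht
      refine hn ⟨hv, fun a h3 h4 h5 => ?_⟩
      rcases anc_cases h5 with rfl | h5
      · exact ht
      · exact hp.2 a h3 h4 h5
    · obtain ⟨ρ1, k1, k2, k3⟩ := ih h2 hp (by omega)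
      exact ⟨ρ1, k1, anc_trans k2 (anc_p v), k3⟩

def I (T : RT G) (ρ : V) : Set V :=
  {v | (v = ρ ∧ ρ ≠ T.r) ∨ (T.Top v ∧ v ≠ T.r ∧ T.p v ∈ T.D ρ)}

open Classical in
noncomputable def att (T : RT G) (ρ v : V) : V := if v = ρ then ρ else T.p v

lemma I_att (h : v ∈ T.I ρ) : T.att ρ v ∈ T.D ρ := by
  unfold att
  split_ifs with h'
  · exact D_self ρ
  · rcases h with h | h
    · exact absurd h.1 h'
    · exact h.2.2

section glue

variable {C : V → V → ℕ} {g : V → ℕ}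
  (hsym : ∀ a b, C a b = C b a)
  (hE : ∀ ρ, T.Top ρ → ρ ≠ T.r → C ρ (T.p ρ) = g ρ)
  (hS : ∀ ρ, T.Top ρ → ∀ u ∈ T.D ρ, ∀ x ∈ T.D ρ, u ≠ x → ∀ q, ∃ s t, t ≠ q ∧
    PP G C (T.D ρ) u x s t)
  (hL : ∀ ρ, T.Top ρ → ∀ i ∈ T.I ρ, ∀ j ∈ T.I ρ, i ≠ j →
    (T.att ρ i = T.att ρ j → g i ≠ g j) ∧
    (T.att ρ i ≠ T.att ρ j → ∃ s t, s ≠ g i ∧ t ≠ g j ∧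
      PP G C (T.D ρ) (T.att ρ i) (T.att ρ j) s t))

include hE hS hL in
lemma climb (hρ : T.Top ρ) (hr : ρ ≠ T.r) (hv : T.anc ρ v) :
    ∃ s, PP G C ({T.p ρ} ∪ {z | T.anc ρ z}) v (T.p ρ) s (g ρ) := by
  induction hn : T.d v - T.d ρ using Nat.strong_induction_on generalizing ρ with
  | _ n ih =>
  have hedge : PP G C ({T.p ρ} ∪ {ρ}) ρ (T.p ρ) (g ρ) (g ρ) :=
    PP.edge' (T.adj ρ hr) (hE ρ hρ hr) (Or.inr rfl) (Or.inl rfl)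
  have hsub : ({T.p ρ} ∪ {ρ} : Set V) ⊆ {T.p ρ} ∪ {z | T.anc ρ z} := by
    rintro z (h | h)
    · exact Or.inl h
    · right; rw [h]; exact anc_refl _
  have hDsub : T.D ρ ⊆ {T.p ρ} ∪ {z | T.anc ρ z} := fun z hz => Or.inr hz.1
  have hint : ∀ z, T.anc ρ z → z ∈ ({T.p ρ} ∪ {ρ} : Set V) → z = ρ := by
    rintro z hz (h | h)
    · rw [h] at hz; exact absurd hz (not_anc_p hr)
    · exact h
  by_cases hvρ : v = ρ
  · subst hvρ
    exact ⟨_, hedge.mono hsub⟩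
  by_cases hvD : v ∈ T.D ρ
  · obtain ⟨s, t, h1, h2⟩ := hS ρ hρ v hvD ρ (D_self ρ) hvρ (g ρ)
    exact ⟨s, h2.append hedge h1 (fun z hz => hint z hz.1) hDsub hsub⟩
  · obtain ⟨ρ1, h1, h2, h3, h4, h5⟩ := exitD hv hvD
    have h6 := anc_strict h3 h4.symm
    obtain ⟨s, hs⟩ := ih (T.d v - T.d ρ1) (by have := anc_le h2; omega) h1 h6.1 h2 rfl
    have hI1 : ρ1 ∈ T.I ρ := Or.inr ⟨h1, h6.1, h5⟩
    have hI : ρ ∈ T.I ρ := Or.inl ⟨rfl, hr⟩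
    have ha1 : T.att ρ ρ1 = T.p ρ1 := if_neg h4
    have ha : T.att ρ ρ = ρ := if_pos rfl
    obtain ⟨k1, k2⟩ := hL ρ hρ ρ1 hI1 ρ hI h4
    rw [ha1, ha] at k1 k2
    have hs1 : ({T.p ρ1} ∪ {z | T.anc ρ1 z} : Set V) ⊆ {z | T.anc ρ z} := by
      rintro z (h | h)
      · rw [h]; exact h6.2.1
      · exact anc_trans h3 h
    by_cases hp : T.p ρ1 = ρ
    · have k := k1 hp
      rw [hp] at hs hs1
      exact ⟨s, hs.append hedge k (fun z hz => hint z (hs1 hz)) (hs1.trans Set.subset_union_right)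
        hsub⟩
    · obtain ⟨s', t', k3, k4, k5⟩ := k2 hp
      have := hs.append k5 k3.symm (D := {z | T.anc ρ z}) (by
        rintro z (h | h) hz
        · exact h
        · exact absurd h1 (hz.2 _ h3 h4 h)) hs1 (fun z hz => hz.1)
      exact ⟨s, this.append hedge k4 (fun z hz => hint z hz) Set.subset_union_right hsub⟩

include hsym hE hS hL in
lemma glue_mixed (hρ : T.Top ρ) (hu : u ∈ T.D ρ) (hx : T.anc ρ x) (hxD : x ∉ T.D ρ) :
    ∃ s t, PP G C Set.univ u x s t := by
  obtain ⟨ρ1, h1, h2, h3, h4, h5⟩ := exitD hx hxD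
  have h6 := anc_strict h3 h4.symm
  obtain ⟨s, hs⟩ := climb hE hS hL h1 h6.1 h2
  have hs := hs.rev hsym
  by_cases hp : u = T.p ρ1
  · rw [← hp] at hs
    exact ⟨_, _, hs.mono (Set.subset_univ _)⟩
  · obtain ⟨s', t', k1, k2⟩ := hS ρ hρ u hu _ h5 hp (g ρ1)
    refine ⟨_, _, k2.append hs k1 ?_ (Set.subset_univ _) (Set.subset_univ _)⟩
    rintro z hz (h | h)
    · exact h
    · exact absurd h1 (hz.2 _ h3 h4 h)

include hsym hE hS hL in
lemma glue_all (hne : u ≠ x) (hρ : T.Top ρ) (hu : T.anc ρ u) (hx : T.anc ρ x) :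
    ∃ s t, PP G C Set.univ u x s t := by
  induction hn : T.d u - T.d ρ using Nat.strong_induction_on generalizing ρ with
  | _ n ih =>
  by_cases huD : u ∈ T.D ρ
  · by_cases hxD : x ∈ T.D ρ
    · obtain ⟨s, t, _, h⟩ := hS ρ hρ u huD x hxD hne 0
      exact ⟨s, t, h.mono (Set.subset_univ _)⟩
    · exact glue_mixed hsym hE hS hL hρ huD hx hxD
  · by_cases hxD : x ∈ T.D ρ
    · obtain ⟨s, t, h⟩ := glue_mixed hsym hE hS hL hρ hxD hu huD
      exact ⟨t, s, h.rev hsym⟩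
    · obtain ⟨ρ1, h1, h2, h3, h4, h5⟩ := exitD hu huD
      obtain ⟨ρ2, k1, k2, k3, k4, k5⟩ := exitD hx hxD
      have h6 := anc_strict h3 h4.symm
      have k6 := anc_strict k3 k4.symm
      by_cases h12 : ρ1 = ρ2
      · subst h12
        exact ih (T.d u - T.d ρ1) (by have := anc_le h2; omega) h1 h2 k2 rfl
      have ha1 : T.att ρ ρ1 = T.p ρ1 := if_neg h4
      have ha2 : T.att ρ ρ2 = T.p ρ2 := if_neg k4
      obtain ⟨e1, e2⟩ := hL ρ hρ ρ1 (Or.inr ⟨h1, h6.1, h5⟩) ρ2 (Or.inr ⟨k1, k6.1, k5⟩) h12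
      rw [ha1, ha2] at e1 e2
      obtain ⟨s, hs⟩ := climb hE hS hL h1 h6.1 h2
      obtain ⟨t, ht⟩ := climb hE hS hL k1 k6.1 k2
      have ht := ht.rev hsym
      have n1 : ∀ z ∈ T.D ρ, ¬ T.anc ρ1 z := fun z hz h => hz.2 _ h3 h4 h h1
      have n2 : ∀ z ∈ T.D ρ, ¬ T.anc ρ2 z := fun z hz h => hz.2 _ k3 k4 h k1
      have n12 : ∀ z, T.anc ρ1 z → T.anc ρ2 z → False := by
        intro z f1 f2
        rcases anc_comp f1 f2 with f | f
        · exact n1 _ k5 (anc_strict f h12).2.1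
        · exact n2 _ h5 (anc_strict f (Ne.symm h12)).2.1
      by_cases hp : T.p ρ1 = T.p ρ2
      · have e := e1 hp
        rw [← hp] at ht
        refine ⟨_, _, hs.append ht e ?_ (Set.subset_univ _) (Set.subset_univ _)⟩
        rintro z (f | f) (f' | f')
        · exact f
        · exact f
        · exact f'
        · exact (n12 z f f').elim
      · obtain ⟨s', t', f1, f2, f3⟩ := e2 hp
        have := hs.append f3 f1.symm (D := {T.p ρ1} ∪ {z | T.anc ρ1 z} ∪ T.D ρ) (by
          rintro z (h | h) hz
          · exact h
          · exact absurd h (n1 z hz)) Set.subset_union_left Set.subset_union_right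
        refine ⟨_, _, this.append ht f2 ?_ (Set.subset_univ _) (Set.subset_univ _)⟩
        rintro z ((f | f) | f) (f' | f')
        · exact f'
        · rw [f] at f'; exact (n2 _ h5 f').elim
        · exact f'
        · exact (n12 z f f').elim
        · exact f'
        · exact (n2 _ f f').elim

end glue

lemma rec_ex (r : V) (d : V → ℕ) (q : V → V) (hq : ∀ v, v ≠ r → d (q v) < d v)
    (F : V → ℕ → ℕ) (c : ℕ) : ∃ g : V → ℕ, g r = c ∧ ∀ v, v ≠ r → g v = F v (g (q v)) := by
  classical
  let g : V → ℕ := (measure d).wf.fix (C := fun _ => ℕ) fun v rec =>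
    if h : v = r then c else F v (rec (q v) (hq v h))
  refine ⟨g, ?_, fun v hv => ?_⟩
  · simp only [g]
    rw [WellFounded.fix_eq]; simp
  · simp only [g]
    rw [WellFounded.fix_eq]; simp [hv]

lemma swap_lt {a b c k : ℕ} (ha : a < k) (hb : b < k) (hc : c < k) : Equiv.swap a b c < k := by
  rw [Equiv.swap_apply_def]; split_ifs <;> assumption

theorem coloring [Fintype V] (T : RT G) (k : ℕ) (hk : 3 ≤ k)
    (hI : ∀ ρ, T.Top ρ → (T.I ρ).ncard ≤ k) :
    ∃ C : V → V → ℕ, (∀ a b, C a b = C b a) ∧ (∀ a b, C a b < k) ∧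
      ∀ u x, u ≠ x → ∃ s t, PP G C Set.univ u x s t := by
  classical
  have hpat : ∀ ρ, ∃ f : V → ℕ, (∀ i, f i < k) ∧ (T.Top ρ →
      (∀ i ∈ T.I ρ, ∀ j ∈ T.I ρ, i ≠ j → T.att ρ i = T.att ρ j → f i ≠ f j) ∧
      (∀ i ∈ T.I ρ, ∀ j ∈ T.I ρ, T.att ρ i ≠ T.att ρ j → ∃ s t, s ≠ f i ∧ t ≠ f j ∧
        PP G T.c0 (T.D ρ) (T.att ρ i) (T.att ρ j) s t)) := by
    intro ρ
    by_cases hρ : T.Top ρ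
    · obtain ⟨f, h1, h2, h3⟩ := pattern hρ k hk (T.I ρ).toFinset
        (by rw [← Set.ncard_eq_toFinset_card']; exact hI ρ hρ) (T.att ρ)
        (fun i hi => I_att (by simpa using hi))
      simp only [Set.mem_toFinset] at h1 h2 h3
      refine ⟨fun i => if i ∈ T.I ρ then f i else 0, ?_, fun _ => ⟨?_, ?_⟩⟩
      · intro i
        simp only
        split_ifs with h
        · exact h1 i h
        · omega
      · intro i hi j hj
        simp only [hi, hj, if_true]
        exact h2 i hi j hj
      · intro i hi j hj
        simp only [hi, hj, if_true]
        exact h3 i hi j hj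
    · exact ⟨fun _ => 0, fun _ => by show 0 < k; omega, fun h => absurd h hρ⟩
  choose f hf1 hf2 using hpat
  choose τ hτ1 hτ2 using T.tau_ex
  have hτ : ∀ ρ v, T.Top ρ → v ∈ T.D ρ → τ v = ρ := fun ρ v h1 h2 =>
    tau_uniq (hτ1 v) h1 (hτ2 v) h2
  obtain ⟨g, hgr, hg⟩ := rec_ex T.r T.d (fun v => τ (T.p v)) (by
    intro v hv
    have := anc_le (hτ2 (T.p v)).1
    have := T.dp v hv
    omega)
    (fun v gq => Equiv.swap gq (f (τ (T.p v)) (τ (T.p v))) (f (τ (T.p v)) v)) (f T.r T.r)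
  have hgk : ∀ v, g v < k := by
    intro v
    induction hn : T.d v using Nat.strong_induction_on generalizing v with
    | _ n ih =>
    by_cases hv : v = T.r
    · rw [hv, hgr]; exact hf1 _ _
    · rw [hg v hv]
      have h1 := anc_le (hτ2 (T.p v)).1
      have h2 := T.dp v hv
      exact swap_lt (ih _ (by omega) _ rfl) (hf1 _ _) (hf1 _ _)
  let π : V → Equiv.Perm ℕ := fun ρ => Equiv.swap (g ρ) (f ρ ρ)
  have hπg : ∀ ρ, T.Top ρ → ∀ v ∈ T.I ρ, π ρ (f ρ v) = g v := by
    rintro ρ hρ v (⟨rfl, h⟩ | ⟨h1, h2, h3⟩)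
    · simp [π]
    · rw [hg v h2]
      simp only [hτ ρ _ hρ h3, π]
  have hπk : ∀ ρ c, c < k → π ρ c < k := fun ρ c hc => swap_lt (hgk _) (hf1 _ _) hc
  let C : V → V → ℕ := fun u v => if T.Top u ∧ u ≠ T.r ∧ T.p u = v then g u else
    if T.Top v ∧ v ≠ T.r ∧ T.p v = u then g v else
    if τ u = τ v then π (τ u) (T.c0 u v) else 0
  have hCs : ∀ a b, C a b = C b a := by
    intro a b
    simp only [C]
    by_cases h1 : T.Top a ∧ a ≠ T.r ∧ T.p a = b
    · have h2 : ¬ (T.Top b ∧ b ≠ T.r ∧ T.p b = a) := by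
        rintro ⟨_, h2, h3⟩
        have e1 := T.dp a h1.2.1
        have e2 := T.dp b h2
        rw [h3] at e2; rw [h1.2.2] at e1; omega
      rw [if_pos h1, if_neg h2, if_pos h1]
    · rw [if_neg h1]
      by_cases h2 : T.Top b ∧ b ≠ T.r ∧ T.p b = a
      · rw [if_pos h2, if_pos h2]
      · rw [if_neg h2, if_neg h2, if_neg h1]
        by_cases h3 : τ a = τ b
        · rw [if_pos h3, if_pos h3.symm, h3, c0_symm]
        · rw [if_neg h3, if_neg (Ne.symm h3)]
  have hCk : ∀ a b, C a b < k := by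
    intro a b
    simp only [C]
    split_ifs
    · exact hgk _
    · exact hgk _
    · exact hπk _ _ (lt_of_lt_of_le (c0_lt _ _) hk)
    · omega
  have hCD : ∀ ρ, T.Top ρ → ∀ a ∈ T.D ρ, ∀ b ∈ T.D ρ, C a b = π ρ (T.c0 a b) := by
    intro ρ hρ a ha b hb
    have key : ∀ a ∈ T.D ρ, ∀ b ∈ T.D ρ, ¬ (T.Top a ∧ a ≠ T.r ∧ T.p a = b) := by
      rintro a ha b hb ⟨h1, h2, rfl⟩
      have := D_top ha h1
      subst this
      exact not_anc_p h2 hb.1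
    simp only [C]
    rw [if_neg (key a ha b hb), if_neg (key b hb a ha), hτ ρ a hρ ha, hτ ρ b hρ hb, if_pos rfl]
  have hmap : ∀ ρ, T.Top ρ → ∀ u x s t, PP G T.c0 (T.D ρ) u x s t →
      PP G C (T.D ρ) u x (π ρ s) (π ρ t) := fun ρ hρ u x s t h =>
    h.map (π ρ) (π ρ).injective (fun a ha b hb _ => hCD ρ hρ a ha b hb)
  refine ⟨C, hCs, hCk, fun u x hne => glue_all (T := T) (g := g) hCs ?_ ?_ ?_ hne top_r
    (anc_root u) (anc_root x)⟩
  · intro ρ h1 h2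
    exact if_pos ⟨h1, h2, rfl⟩
  · intro ρ hρ u hu x hx hux q
    obtain ⟨s, t, h1, h2⟩ := main_S hρ hu hx hux ((π ρ).symm q)
    refine ⟨_, _, ?_, hmap ρ hρ _ _ _ _ h2⟩
    intro h; exact h1 (by rw [← h]; simp)
  · intro ρ hρ i hi j hj hij
    refine ⟨fun h => ?_, fun h => ?_⟩
    · rw [← hπg ρ hρ i hi, ← hπg ρ hρ j hj]
      exact fun h' => (hf2 ρ hρ).1 i hi j hj hij h ((π ρ).injective h')
    · obtain ⟨s, t, h1, h2, h3⟩ := (hf2 ρ hρ).2 i hi j hj h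
      refine ⟨_, _, ?_, ?_, hmap ρ hρ _ _ _ _ h3⟩
      · rw [← hπg ρ hρ i hi]; exact fun h' => h1 ((π ρ).injective h')
      · rw [← hπg ρ hρ j hj]; exact fun h' => h2 ((π ρ).injective h')

end RT

namespace RT

variable {V : Type*} {G : SimpleGraph V} {T : RT G} {ρ ρ1 ρ2 u v w x y z : V}

def Normal (T : RT G) : Prop := ∀ u v, G.Adj u v → T.anc u v ∨ T.anc v u

lemma base (hG : G.Connected) : ∃ _ : RT G, True := by
  classical
  obtain ⟨r⟩ := hG.nonempty
  have h : ∀ v, v ≠ r → ∃ w, G.Adj v w ∧ G.dist v r = G.dist w r + 1 := by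
    intro v hv
    obtain ⟨p, hp⟩ := hG.exists_walk_length_eq_dist v r
    cases p with
    | nil => exact absurd rfl hv
    | @cons _ w _ h q =>
      refine ⟨w, h, ?_⟩
      rw [SimpleGraph.Walk.length_cons] at hp
      have h1 := SimpleGraph.dist_le q
      obtain ⟨q', hq'⟩ := hG.exists_walk_length_eq_dist w r
      have h2 := SimpleGraph.dist_le (SimpleGraph.Walk.cons h q')
      rw [SimpleGraph.Walk.length_cons] at h2
      omega
  choose! f hf using h
  refine ⟨⟨r, fun v => if v = r then r else f v, fun v => G.dist v r, by simp, by simp, ?_, ?_⟩,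
    trivial⟩
  · intro v hv
    simp only [hv, if_false]
    exact (hf v hv).1
  · intro v hv
    simp only [hv, if_false]
    exact (hf v hv).2

lemma d_iter (v : V) (n : ℕ) : T.d (T.p^[n] v) = T.d v - n := by
  induction n generalizing v with
  | zero => simp
  | succ n ih =>
    rw [Function.iterate_succ_apply, ih]
    by_cases h : v = T.r
    · rw [h, T.pr, T.dr]; omega
    · have := T.dp v h; omega

lemma d_lt [Fintype V] (v : V) : T.d v < Fintype.card V := by
  have h : (Finset.range (T.d v + 1)).card ≤ (Finset.univ : Finset V).card := by
    refine Finset.card_le_card_of_injOn (fun n => T.p^[n] v) (by intro x _; simp) ?_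
    intro a ha b hb hab
    have := congrArg T.d hab
    simp only [d_iter] at this
    simp at ha hb
    omega
  rw [Finset.card_range, Finset.card_univ] at h
  omega

lemma rehang [Fintype V] (h : G.Adj u v) (h1 : ¬ T.anc u v) (h2 : ¬ T.anc v u)
    (hd : T.d v ≤ T.d u) : ∃ T' : RT G, ∑ x, T.d x < ∑ x, T'.d x := by
  classical
  have hvr : v ≠ T.r := by rintro rfl; exact h2 (anc_root u)
  refine ⟨⟨T.r, fun x => if x = v then u else T.p x,
    fun x => if T.anc v x then T.d x + (T.d u + 1 - T.d v) else T.d x, ?_, ?_, ?_, ?_⟩, ?_⟩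
  · simp only [hvr.symm, if_false]; exact T.pr
  · have : ¬ T.anc v T.r := fun h => hvr (anc_r h)
    simp only [this, if_false]; exact T.dr
  · intro x hx
    split_ifs with h3
    · rw [h3]; exact h.symm
    · exact T.adj x hx
  · intro x hx
    by_cases h3 : x = v
    · subst h3
      simp only [anc_refl, if_true, h2, if_false]
      omega
    · have h4 : T.anc v x ↔ T.anc v (T.p x) :=
        ⟨fun h => (anc_strict h (Ne.symm h3)).2.1, fun h => anc_trans h (anc_p x)⟩
      have := T.dp x hx
      simp only [h3, if_false, h4]
      split_ifs <;> omega
  · refine Finset.sum_lt_sum (fun x _ => ?_) ⟨v, Finset.mem_univ _, ?_⟩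
    · simp only
      split_ifs <;> omega
    · simp only [anc_refl, if_true]
      omega

lemma normal_ex [Fintype V] (hG : G.Connected) : ∃ T : RT G, T.Normal := by
  obtain ⟨T0, -⟩ := base hG
  let M := Fintype.card V * Fintype.card V
  have hM : ∀ T : RT G, ∑ x, T.d x ≤ M := by
    intro T
    calc ∑ x, T.d x ≤ ∑ _x : V, Fintype.card V := Finset.sum_le_sum fun x _ => (d_lt x).le
      _ = M := by simp [M]
  obtain ⟨T, -, hT⟩ := (measure fun T : RT G => M - ∑ x, T.d x).wf.has_min Set.univ ⟨T0, trivial⟩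
  have hT' : ∀ T' : RT G, ¬ ∑ x, T.d x < ∑ x, T'.d x := by
    intro T' h
    apply hT T' trivial
    show M - ∑ x, T'.d x < M - ∑ x, T.d x
    have := hM T'
    omega
  refine ⟨T, fun u v h => ?_⟩
  by_contra hn
  push Not at hn
  rcases le_total (T.d v) (T.d u) with hd | hd
  · obtain ⟨T', h'⟩ := rehang h hn.1 hn.2 hd
    exact hT' T' h'
  · obtain ⟨T', h'⟩ := rehang h.symm hn.2 hn.1 hd
    exact hT' T' h'

end RT

namespace RT

variable {V : Type*} {G K : SimpleGraph V} {T : RT G} {ρ ρ1 ρ2 u v w x y z : V}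

lemma treach (h : T.anc u v)
    (hK : ∀ x, T.anc u x → T.anc x v → x ≠ u → K.Adj x (T.p x)) : K.Reachable v u := by
  induction hn : T.d v generalizing v with
  | zero =>
    have := anc_eq h (by omega)
    rw [this]
  | succ n ih =>
    by_cases huv : u = v
    · rw [huv]
    · obtain ⟨h1, h2, _⟩ := anc_strict h huv
      have := T.dp v h1
      exact (hK v h (anc_refl v) (Ne.symm huv)).reachable.trans
        (ih h2 (fun x k1 k2 k3 => hK x k1 (anc_trans k2 (anc_p v)) k3) (by omega))

lemma edge_inj (hx : x ≠ T.r) (hv : v ≠ T.r) (h : s(x, T.p x) = s(v, T.p v)) : x = v := by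
  rw [Sym2.eq_iff] at h
  rcases h with h | h
  · exact h.1
  · exfalso
    have h1 := T.dp x hx
    have h2 := T.dp v hv
    rw [h.2] at h1; rw [← h.1] at h2; omega

lemma esc_not_bridge (hv : v ≠ T.r) (h : T.Esc v z y) : ¬ G.IsBridge s(v, T.p v) := by
  rw [SimpleGraph.isBridge_iff, not_not]
  obtain ⟨h1, h2, h3, h4, h5⟩ := h
  have hvr : T.d v = T.d (T.p v) + 1 := T.dp v hv
  have e1 : (G.deleteEdges {s(v, T.p v)}).Reachable z v := by
    refine treach h1 fun x k1 k2 k3 => ?_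
    have hx := (anc_strict k1 k3.symm).1
    rw [SimpleGraph.deleteEdges_adj]
    exact ⟨T.adj x hx, fun h => k3 (edge_inj hx hv h)⟩
  have e2 : (G.deleteEdges {s(v, T.p v)}).Adj z y := by
    rw [SimpleGraph.deleteEdges_adj]
    refine ⟨h2, fun h => ?_⟩
    rw [Set.mem_singleton_iff, Sym2.eq_iff] at h
    rcases h with h | h
    · rw [h.1, h.2] at h5; omega
    · exact h4 h.2
  have e3 : (G.deleteEdges {s(v, T.p v)}).Reachable (T.p v) y := by
    refine treach (anc_strict h3 h4).2.1 fun x k1 k2 k3 => ?_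
    have hx := (anc_strict k1 k3.symm).1
    rw [SimpleGraph.deleteEdges_adj]
    refine ⟨T.adj x hx, fun h => ?_⟩
    have := edge_inj hx hv h
    subst this
    exact not_anc_p hv k2
  exact e1.symm.trans (e2.reachable.trans e3.symm)

lemma top_bridge (hN : T.Normal) (hv : v ≠ T.r) (ht : T.Top v) : G.IsBridge s(v, T.p v) := by
  rw [SimpleGraph.isBridge_iff]
  intro h
  have step : ∀ x y, (G.deleteEdges {s(v, T.p v)}).Adj x y → T.anc v x → T.anc v y := by
    intro x y hxy hx
    rw [SimpleGraph.deleteEdges_adj] at hxy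
    obtain ⟨h1, h2⟩ := hxy
    rcases hN x y h1 with h3 | h3
    · exact anc_trans hx h3
    · rcases anc_comp hx h3 with h4 | h4
      · exact h4
      · by_cases h5 : y = v
        · rw [h5]; exact anc_refl v
        · exfalso
          by_cases h6 : T.d y + 2 ≤ T.d x
          · exact ht x y ⟨hx, h1, h4, h5, h6⟩
          · obtain ⟨k1, k2, k3⟩ := anc_strict h4 h5
            have k4 := T.dp v hv
            have k5 := anc_le hx
            have k6 := anc_eq hx (by omega)
            have k7 := anc_eq k2 (by omega)
            subst k6 k7
            exact h2 rfl
  obtain ⟨p⟩ := h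
  have : ∀ a b (p : (G.deleteEdges {s(v, T.p v)}).Walk a b), T.anc v a → T.anc v b := by
    intro a b p
    induction p with
    | nil => exact id
    | cons h q ih => exact fun h' => ih (step _ _ h h')
  exact not_anc_p hv (this _ _ p (anc_refl v))

lemma D_reach (hv : v ∈ T.D ρ) :
    (G.deleteEdges {e | G.IsBridge e}).Reachable v ρ := by
  refine treach hv.1 fun x k1 k2 k3 => ?_
  have hx := (anc_strict k1 k3.symm).1
  obtain ⟨z, y, h⟩ := not_top.1 (hv.2 x k1 k3 k2)
  rw [SimpleGraph.deleteEdges_adj]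
  exact ⟨T.adj x hx, esc_not_bridge hx h⟩

lemma D_adj (hN : T.Normal) (hρ : T.Top ρ)
    (h : (G.deleteEdges {e | G.IsBridge e}).Adj u v) (huv : T.anc u v) :
    u ∈ T.D ρ ↔ v ∈ T.D ρ := by
  rw [SimpleGraph.deleteEdges_adj] at h
  obtain ⟨h1, h2⟩ := h
  have key : ∀ a, T.anc u a → a ≠ u → T.anc a v → ¬ T.Top a := by
    intro a k1 k2 k3 ht
    by_cases hd : T.d u + 2 ≤ T.d v
    · exact ht v u ⟨k3, h1.symm, k1, k2.symm, hd⟩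
    · obtain ⟨e1, e2, e3⟩ := anc_strict huv h1.ne
      have e4 := T.dp v e1
      have e5 := anc_lt k1 k2.symm
      have e6 := anc_eq k3 (by omega)
      have e7 := anc_eq e2 (by omega)
      subst e6
      apply h2
      rw [e7, Sym2.eq_swap]
      exact top_bridge hN e1 ht
  constructor
  · intro hu
    refine ⟨anc_trans hu.1 huv, fun a k1 k2 k3 => ?_⟩
    rcases anc_comp k3 huv with h | h
    · exact hu.2 a k1 k2 h
    · by_cases e : a = u
      · rw [e] at k1 k2 ⊢
        exact hu.2 u k1 k2 (anc_refl u)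
      · exact key a h e k3
  · intro hv
    refine D_down hv ?_ huv
    rcases anc_comp hv.1 huv with h | h
    · exact h
    · by_cases e : ρ = u
      · rw [e]; exact anc_refl u
      · exact absurd hρ (key ρ h e hv.1)

lemma reach_D (hN : T.Normal) (hρ : T.Top ρ)
    (h : (G.deleteEdges {e | G.IsBridge e}).Reachable u v) (hu : u ∈ T.D ρ) : v ∈ T.D ρ := by
  obtain ⟨p⟩ := h
  induction p with
  | nil => exact hu
  | @cons a b c h q ih =>
    apply ih
    rcases hN a b (SimpleGraph.deleteEdges_le _ h) with h' | h'
    · exact (D_adj hN hρ h h').1 hu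
    · exact (D_adj hN hρ h.symm h').2 hu

lemma I_card [Fintype V] (hN : T.Normal) (hρ : T.Top ρ) :
    (T.I ρ).ncard ≤ {D | (bridgeTree G).Adj
      ((G.deleteEdges {e | G.IsBridge e}).connectedComponentMk ρ) D}.ncard := by
  classical
  have hcross : ∀ w, T.Top w → w ≠ ρ → T.p w ∈ T.D ρ → ρ ≠ T.r →
      ¬ (G.deleteEdges {e | G.IsBridge e}).Reachable (T.p ρ) w := by
    intro w h1 h2 h3 hr h
    have h4 := reach_D hN h1 h.symm (D_self w)
    exact not_anc_p hr (anc_trans h3.1 (anc_trans (anc_p w) h4.1))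
  refine Set.ncard_le_ncard_of_injOn
    (fun v => if v = ρ then (G.deleteEdges {e | G.IsBridge e}).connectedComponentMk (T.p ρ)
      else (G.deleteEdges {e | G.IsBridge e}).connectedComponentMk v) ?_ ?_ (Set.toFinite _)
  · rintro v hv
    simp only [Set.mem_setOf_eq]
    unfold bridgeTree
    rw [SimpleGraph.fromRel_adj]
    by_cases hvρ : v = ρ
    · subst hvρ
      have hr : v ≠ T.r := by
        rcases hv with h | h
        · exact h.2
        · exact h.2.1
      rw [if_pos rfl]
      refine ⟨fun h => ?_, Or.inl ⟨v, T.p v, rfl, rfl, T.adj v hr⟩⟩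
      have := reach_D hN hρ (SimpleGraph.ConnectedComponent.exact h) (D_self v)
      exact not_anc_p hr this.1
    · rw [if_neg hvρ]
      rcases hv with h | ⟨h1, h2, h3⟩
      · exact absurd h.1 hvρ
      refine ⟨fun h => ?_, Or.inl ⟨T.p v, v, SimpleGraph.ConnectedComponent.sound (D_reach h3), rfl,
        (T.adj v h2).symm⟩⟩
      have := reach_D hN hρ (SimpleGraph.ConnectedComponent.exact h) (D_self ρ)
      exact hvρ (D_top this h1)
  · intro v hv w hw hvw
    simp only at hvw
    by_cases hvρ : v = ρ
    · by_cases hwρ : w = ρ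
      · rw [hvρ, hwρ]
      · rw [if_pos hvρ, if_neg hwρ] at hvw
        have hr : ρ ≠ T.r := by
          rcases hv with h | h
          · exact h.2
          · exact hvρ ▸ h.2.1
        rcases hw with h | ⟨h1, h2, h3⟩
        · exact absurd h.1 hwρ
        · exact absurd (SimpleGraph.ConnectedComponent.exact hvw) (hcross w h1 hwρ h3 hr)
    · rcases hv with h | ⟨h1, h2, h3⟩
      · exact absurd h.1 hvρ
      by_cases hwρ : w = ρ
      · rw [if_neg hvρ, if_pos hwρ] at hvw
        have hr : ρ ≠ T.r := by
          rcases hw with h | h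
          · exact h.2
          · exact hwρ ▸ h.2.1
        exact absurd (SimpleGraph.ConnectedComponent.exact hvw).symm (hcross v h1 hvρ h3 hr)
      · rw [if_neg hvρ, if_neg hwρ] at hvw
        rcases hw with h | ⟨k1, k2, k3⟩
        · exact absurd h.1 hwρ
        exact D_top (reach_D hN k1 (SimpleGraph.ConnectedComponent.exact hvw).symm (D_self w)) h1

end RT


theorem stmt6 {V : Type*} [Fintype V] (G : SimpleGraph V) (hconn : G.Connected)
    (Δstar : ℕ)
    (hΔ : Δstar = sSup {d : ℕ |
      ∃ C : (G.deleteEdges {e | G.IsBridge e}).ConnectedComponent,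
        d = {D | (bridgeTree G).Adj C D}.ncard}) :
    pc G ≤ max 3 Δstar := by
  obtain ⟨T, hN⟩ := RT.normal_ex hconn
  have hfin : {d : ℕ | ∃ C : (G.deleteEdges {e | G.IsBridge e}).ConnectedComponent,
        d = {D | (bridgeTree G).Adj C D}.ncard}.Finite := by
    have := Set.finite_range fun C : (G.deleteEdges {e | G.IsBridge e}).ConnectedComponent =>
      {D | (bridgeTree G).Adj C D}.ncard
    refine this.subset ?_
    rintro d ⟨C, rfl⟩
    exact ⟨C, rfl⟩
  have hI : ∀ ρ, T.Top ρ → (T.I ρ).ncard ≤ max 3 Δstar := by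
    intro ρ hρ
    refine (RT.I_card hN hρ).trans (le_trans ?_ (le_max_right _ _))
    rw [hΔ]
    exact le_csSup hfin.bddAbove ⟨_, rfl⟩
  obtain ⟨C, h1, h2, h3⟩ := T.coloring (max 3 Δstar) (le_max_left _ _) hI
  refine Nat.sInf_le ⟨Sym2.lift ⟨C, h1⟩, ?_, ?_⟩
  · intro e _
    induction e with
    | _ a b => exact h2 a b
  · intro u v huv
    obtain ⟨s, t, h⟩ := h3 u v huv
    obtain ⟨p, k1, -, k2, -⟩ := h.toWalk (e := Sym2.lift ⟨C, h1⟩) (fun a b => rfl)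
    exact ⟨p, k1, k2⟩
end
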